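/- arXiv:1306.0780 — 3 statements merged into one kernel-verified Lean document; each statement's English description precedes it below -/
import Mathlib

section
/- Change of variables for regularized integrals: Let f : ℝ₊ → ℂ be regularized-integrable with asymptotic expansions at 0 and ∞ containing no terms x^{-1} log^k x with k ≥ 1, and let A_∞ (resp. A_0) be the coefficient of x^{-1} in the expansion as x → ∞ (resp. x → 0). Then for every λ > 0: ⨍_0^∞ f(x) dx = λ ⨍_0^∞ f(λx) dx - A_∞ log λ + A_0 log λ. -/
open MeasureTheory Filter Asymptotics

noncomputable section

/-- A term `x ^ α * (log x) ^ k` of a partie-finie asymptotic expansion. -/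
def CTerm (p : ℂ × ℕ) (x : ℝ) : ℂ :=
  (x : ℂ) ^ p.1 * (Real.log x : ℂ) ^ p.2

/-- Hadamard partie finie regularized limit as `x → ∞`: `g` has an asymptotic expansion
`g(x) ~ ∑ A p * x ^ p.1 * log x ^ p.2 + c + o(1)` where all expansion terms are
non-decaying and non-constant; `c` is the constant term `a₀₀`. -/
def HasRegLimAtTop (g : ℝ → ℂ) (c : ℂ) : Prop :=
  ∃ (s : Finset (ℂ × ℕ)) (A : ℂ × ℕ → ℂ),
    (∀ p ∈ s, 0 ≤ p.1.re ∧ p ≠ (0, 0)) ∧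
    Tendsto (fun x => g x - ∑ p ∈ s, A p * CTerm p x - c) atTop (nhds 0)

/-- Hadamard partie finie regularized limit as `x → 0⁺`. -/
def HasRegLimAtZero (g : ℝ → ℂ) (c : ℂ) : Prop :=
  ∃ (s : Finset (ℂ × ℕ)) (A : ℂ × ℕ → ℂ),
    (∀ p ∈ s, p.1.re ≤ 0 ∧ p ≠ (0, 0)) ∧
    Tendsto (fun x => g x - ∑ p ∈ s, A p * CTerm p x - c) (nhdsWithin 0 (Set.Ioi 0)) (nhds 0)

/-- `⨍_a^∞ g = v` : the regularized integral of `g` from `a` to `∞` equals `v`.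
For `a ≠ 0` it is `LIM_{R→∞} ∫_a^R g`; for `a = 0` one additionally regularizes at the
lower endpoint: `⨍_0^∞ g = LIM_{ε→0} ∫_ε^1 g + LIM_{R→∞} ∫_1^R g`. -/
def HasRegInt (g : ℝ → ℂ) (a : ℝ) (v : ℂ) : Prop :=
  (a ≠ 0 ∧ HasRegLimAtTop (fun R => ∫ x in a..R, g x) v) ∨
  (a = 0 ∧ ∃ v₀ v₁ : ℂ,
    HasRegLimAtZero (fun e => ∫ x in e..1, g x) v₀ ∧
    HasRegLimAtTop (fun R => ∫ x in (1:ℝ)..R, g x) v₁ ∧ v = v₀ + v₁)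

/-- Regularized limit of a sequence (partie finie of the expansion in `N`). -/
def HasRegLimSeq (g : ℕ → ℂ) (c : ℂ) : Prop :=
  ∃ (s : Finset (ℂ × ℕ)) (A : ℂ × ℕ → ℂ),
    (∀ p ∈ s, 0 ≤ p.1.re ∧ p ≠ (0, 0)) ∧
    Tendsto (fun N : ℕ => g N - ∑ p ∈ s, A p * CTerm p (N : ℝ) - c) atTop (nhds 0)

/-- Regularized sum `Σ-reg_{l=l₀}^∞ g l = v`, the regularized limit of partial sums. -/
def HasRegSum (g : ℕ → ℂ) (l₀ : ℕ) (v : ℂ) : Prop :=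
  HasRegLimSeq (fun N => ∑ l ∈ Finset.Icc l₀ N, g l) v

/-- The closed quarter plane minus the origin. -/
def Qset : Set (ℝ × ℝ) := {p | 0 ≤ p.1 ∧ 0 ≤ p.2} \ {0}

/-- Homogeneity of complex degree `α` on the quarter plane. -/
def Homog (f : ℝ × ℝ → ℂ) (α : ℂ) : Prop :=
  ∀ l : ℝ, 0 < l → ∀ p : ℝ × ℝ, p ∈ Qset →
    f (l * p.1, l * p.2) = (l : ℂ) ^ α * f p

/-- Taylor coefficient `c_j = (∂₁^j f)(0,1)/j!` of the expansion of `f` as `y → ∞`. -/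
def cCoef (f : ℝ × ℝ → ℂ) (j : ℕ) : ℂ :=
  (j.factorial : ℂ)⁻¹ * iteratedDerivWithin j (fun t => f (t, 1)) (Set.Ici 0) 0

/-- Taylor coefficient `d_j = (∂₂^j f)(1,0)/j!` of the expansion of `f` as `x → ∞`. -/
def dCoef (f : ℝ × ℝ → ℂ) (j : ℕ) : ℂ :=
  (j.factorial : ℂ)⁻¹ * iteratedDerivWithin j (fun t => f (1, t)) (Set.Ici 0) 0

open Classical in
/-- `c_{α+1}`: the coefficient `c_j` with `j = α + 1` if `α + 1 ∈ ℕ`, and `0` otherwise. -/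
def cCrit (f : ℝ × ℝ → ℂ) (α : ℂ) : ℂ :=
  if h : ∃ j : ℕ, α + 1 = (j : ℂ) then cCoef f h.choose else 0

open Classical in
/-- `d_{α+1}`: the coefficient `d_j` with `j = α + 1` if `α + 1 ∈ ℕ`, and `0` otherwise. -/
def dCrit (f : ℝ × ℝ → ℂ) (α : ℂ) : ℂ :=
  if h : ∃ j : ℕ, α + 1 = (j : ℂ) then dCoef f h.choose else 0

end

theorem Complex.exists_exp_mul_ofReal_ne_one {a : ℂ} (ha : a ≠ 0) :
    ∃ h : ℝ, Complex.exp (a * h) ≠ 1 := by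
  refine ⟨‖a‖⁻¹, fun H => ?_⟩
  obtain ⟨n, hn⟩ := Complex.exp_eq_one_iff.1 H
  have hna : ‖a‖ ≠ 0 := norm_ne_zero_iff.2 ha
  have hnorm : (1 : ℝ) = |(n : ℝ)| * (2 * Real.pi) := by
    have := congrArg norm hn
    simpa [hna, abs_of_pos Real.pi_pos] using this
  have hn0 : n ≠ 0 := by
    rintro rfl
    simp at hnorm
  have h1 : (1 : ℝ) ≤ |(n : ℝ)| := by exact_mod_cast Int.one_le_abs hn0
  nlinarith [Real.pi_gt_three]

/-- The polynomial part of an exponential polynomial that tends to zero along a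
translation-invariant filter at infinity vanishes. -/
theorem Polynomial.eq_zero_of_tendsto_add_sum_exp {L : Filter ℝ} [L.NeBot]
    (hshift : ∀ h : ℝ, Tendsto (fun t => t + h) L L)
    (hnorm : Tendsto (fun t : ℝ => ‖t‖) L atTop) (S : Finset ℂ) :
    0 ∉ S → ∀ (Q : Polynomial ℂ) (P : ℂ → Polynomial ℂ),
      Tendsto (fun t : ℝ => Q.eval (t : ℂ) +
        ∑ α ∈ S, Complex.exp (α * t) * (P α).eval (t : ℂ)) L (nhds 0) → Q = 0 := by
  induction S using Finset.induction_on with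
  | empty =>
    intro _ Q P hlim
    simp only [Finset.sum_empty, add_zero] at hlim
    by_cases hdeg : 0 < Q.degree
    · have hQ : Tendsto (fun t : ℝ => ‖Q.eval (t : ℂ)‖) L atTop :=
        Q.tendsto_norm_atTop hdeg (by simpa using hnorm)
      exact absurd hlim.norm (not_tendsto_nhds_of_tendsto_atTop hQ _)
    · rw [Polynomial.eq_C_of_degree_le_zero (not_lt.1 hdeg)] at hlim ⊢
      simp only [Polynomial.eval_C] at hlim
      rw [tendsto_nhds_unique tendsto_const_nhds hlim, Polynomial.C_0]
  | insert a S haS ih =>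
    intro h0 Q P hlim
    have ha : a ≠ 0 := fun h => h0 (h ▸ Finset.mem_insert_self a S)
    have hS : 0 ∉ S := fun h => h0 (Finset.mem_insert_of_mem h)
    obtain ⟨h, hE⟩ := Complex.exists_exp_mul_ofReal_ne_one ha
    obtain ⟨n, hn⟩ : ∃ n : ℕ, (P a).degree < n :=
      ⟨(P a).natDegree + 1, Polynomial.degree_le_natDegree.trans_lt <| by
        exact_mod_cast Nat.lt_succ_self _⟩
    induction n generalizing Q P with
    | zero =>
      have hPa : P a = 0 := Polynomial.degree_eq_bot.1 (by simpa using hn)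
      refine ih hS Q P ?_
      simpa [Finset.sum_insert haS, hPa] using hlim
    | succ n ihn =>
      set E := Complex.exp (a * h) with hEdef
      have hQ' : Polynomial.taylor (h : ℂ) Q - Polynomial.C E * Q = 0 := by
        refine ihn _ (fun α => Polynomial.C (Complex.exp (α * h)) *
          Polynomial.taylor (h : ℂ) (P α) - Polynomial.C E * P α) ?_ ?_
        · have := (hlim.comp (hshift h)).sub (hlim.const_mul E)
          simp only [mul_zero, sub_zero] at this
          refine this.congr fun t => ?_
          simp only [Function.comp_apply, Polynomial.eval_sub, Polynomial.eval_mul,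
            Polynomial.eval_C, Polynomial.taylor_eval, Complex.ofReal_add, mul_add, mul_sub,
            Complex.exp_add, Finset.sum_sub_distrib, Finset.mul_sum]
          have h1 : ∀ α : ℂ, Complex.exp (α * t) * Complex.exp (α * h) *
              (P α).eval ((t : ℂ) + h) = Complex.exp (α * t) *
              (Complex.exp (α * h) * (P α).eval ((t : ℂ) + h)) := fun α => by ring
          have h2 : ∀ α : ℂ, E * (Complex.exp (α * t) * (P α).eval (t : ℂ)) =
              Complex.exp (α * t) * (E * (P α).eval (t : ℂ)) := fun α => by ring
          simp only [h1, h2]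
          ring
        · rw [← hEdef, ← mul_sub, Polynomial.degree_C_mul (Complex.exp_ne_zero _)]
          by_cases hPa : P a = 0
          · simp [hPa]
          · have hlt := Polynomial.degree_sub_lt_left (Polynomial.degree_taylor (P a) (h : ℂ))
              (by simpa using hPa) (by rw [Polynomial.leadingCoeff_taylor])
            rw [Polynomial.degree_taylor] at hlt
            refine hlt.trans_le ?_
            rw [Polynomial.degree_eq_natDegree hPa] at hn ⊢
            have : (P a).natDegree < n + 1 := by exact_mod_cast hn
            exact_mod_cast Nat.lt_succ_iff.1 this
      have hlead : (1 - E) * Q.leadingCoeff = 0 := by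
        have := congrArg (fun p : Polynomial ℂ => p.coeff Q.natDegree) hQ'
        simp only [Polynomial.coeff_sub, Polynomial.coeff_taylor_natDegree,
          Polynomial.coeff_C_mul, Polynomial.coeff_zero, Polynomial.coeff_natDegree] at this
        rw [sub_mul, one_mul, this]
      exact Polynomial.leadingCoeff_eq_zero.1
        ((mul_eq_zero.1 hlead).resolve_left (sub_ne_zero.2 (Ne.symm hE)))

/-- The span of the non-constant terms `x ^ α * (log x) ^ k`. -/
def nonconstSpan : Submodule ℂ (ℝ → ℂ) :=
  Submodule.span ℂ (CTerm '' {p | p ≠ (0, 0)})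

theorem cTerm_mem_nonconstSpan {p : ℂ × ℕ} (hp : p ≠ (0, 0)) : CTerm p ∈ nonconstSpan :=
  Submodule.subset_span ⟨p, hp, rfl⟩

theorem cTerm_exp (p : ℂ × ℕ) (t : ℝ) :
    CTerm p (Real.exp t) = Complex.exp (p.1 * t) * (t : ℂ) ^ p.2 := by
  have hne : (Real.exp t : ℂ) ≠ 0 := by exact_mod_cast (Real.exp_pos t).ne'
  rw [CTerm, Complex.cpow_def_of_ne_zero hne, ← Complex.ofReal_log (Real.exp_pos t).le,
    Real.log_exp, mul_comm p.1]

theorem eq_zero_of_tendsto_nonconstSpan_comp_exp {L : Filter ℝ} [L.NeBot]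
    (hshift : ∀ h : ℝ, Tendsto (fun t => t + h) L L)
    (hnorm : Tendsto (fun t : ℝ => ‖t‖) L atTop) {P : ℝ → ℂ} (hP : P ∈ nonconstSpan) {c : ℂ}
    (hlim : Tendsto (fun t => P (Real.exp t) + c) L (nhds 0)) : c = 0 := by
  obtain ⟨w, hw, rfl⟩ := (Finsupp.mem_span_image_iff_linearCombination ℂ).1 hP
  set R : ℂ → Polynomial ℂ := fun α =>
    ∑ p ∈ w.support with p.1 = α, Polynomial.C (w p) * Polynomial.X ^ p.2 with hR
  have hQ : Polynomial.C c + R 0 = 0 := by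
    refine Polynomial.eq_zero_of_tendsto_add_sum_exp hshift hnorm
      ((w.support.image Prod.fst).erase 0) (by simp) _ R (hlim.congr fun t => ?_)
    have hsum : ∑ α ∈ insert 0 (w.support.image Prod.fst),
        Complex.exp (α * t) * (R α).eval (t : ℂ) =
        ∑ p ∈ w.support, w p * (Complex.exp (p.1 * t) * (t : ℂ) ^ p.2) := by
      rw [← Finset.sum_fiberwise_of_maps_to (g := Prod.fst)
        (t := insert 0 (w.support.image Prod.fst))
        (fun p hp => Finset.mem_insert_of_mem (Finset.mem_image_of_mem _ hp))]
      refine Finset.sum_congr rfl fun α _ => ?_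
      simp only [hR, Polynomial.eval_finsetSum, Polynomial.eval_mul, Polynomial.eval_C,
        Polynomial.eval_pow, Polynomial.eval_X, Finset.mul_sum]
      refine Finset.sum_congr rfl fun p hp => ?_
      rw [(Finset.mem_filter.1 hp).2]
      ring
    rw [← Finset.add_sum_erase _ _ (Finset.mem_insert_self 0 _), Finset.erase_insert_eq_erase]
      at hsum
    simp only [Finsupp.linearCombination_apply, Finsupp.sum, Finset.sum_apply, Pi.smul_apply,
      smul_eq_mul, cTerm_exp, Polynomial.eval_add, Polynomial.eval_C]
    rw [← hsum]
    simp only [zero_mul, Complex.exp_zero, one_mul]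
    ring
  have hR0 : (R 0).coeff 0 = 0 := by
    rw [hR, Polynomial.finsetSum_coeff]
    refine Finset.sum_eq_zero fun p hp => ?_
    obtain ⟨hpw, hp0⟩ := Finset.mem_filter.1 hp
    have hp2 : p.2 ≠ 0 := fun h => hw hpw (Prod.ext hp0 h)
    simp [Polynomial.coeff_X_pow, hp2.symm]
  simpa [hR0] using congrArg (fun p : Polynomial ℂ => p.coeff 0) hQ

theorem eq_zero_of_tendsto_nonconstSpan_atTop {P : ℝ → ℂ} (hP : P ∈ nonconstSpan) {c : ℂ}
    (hlim : Tendsto (fun x => P x + c) atTop (nhds 0)) : c = 0 :=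
  eq_zero_of_tendsto_nonconstSpan_comp_exp
    (fun h => tendsto_atTop_add_const_right _ h tendsto_id) tendsto_norm_atTop_atTop hP
    (hlim.comp Real.tendsto_exp_atTop)

theorem eq_zero_of_tendsto_nonconstSpan_nhdsGT_zero {P : ℝ → ℂ} (hP : P ∈ nonconstSpan) {c : ℂ}
    (hlim : Tendsto (fun x => P x + c) (nhdsWithin 0 (Set.Ioi 0)) (nhds 0)) : c = 0 :=
  eq_zero_of_tendsto_nonconstSpan_comp_exp
    (fun h => tendsto_atBot_add_const_right _ h tendsto_id) tendsto_abs_atBot_atTop hP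
    (hlim.comp Real.tendsto_exp_atBot_nhdsGT)

theorem sum_cTerm_mem_nonconstSpan {s : Finset (ℂ × ℕ)} (A : ℂ × ℕ → ℂ)
    (hs : ∀ p ∈ s, p ≠ (0, 0)) : (fun x => ∑ p ∈ s, A p * CTerm p x) ∈ nonconstSpan := by
  have : (fun x => ∑ p ∈ s, A p * CTerm p x) = ∑ p ∈ s, A p • CTerm p := by
    ext x
    simp
  rw [this]
  exact Submodule.sum_mem _ fun p hp => Submodule.smul_mem _ _ (cTerm_mem_nonconstSpan (hs p hp))

theorem HasRegLimAtTop.exists_nonconstSpan {g : ℝ → ℂ} {c : ℂ} (h : HasRegLimAtTop g c) :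
    ∃ P ∈ nonconstSpan, Tendsto (fun x => g x - P x - c) atTop (nhds 0) := by
  obtain ⟨s, A, hs, hlim⟩ := h
  exact ⟨_, sum_cTerm_mem_nonconstSpan A fun p hp => (hs p hp).2, hlim⟩

theorem HasRegLimAtZero.exists_nonconstSpan {g : ℝ → ℂ} {c : ℂ} (h : HasRegLimAtZero g c) :
    ∃ P ∈ nonconstSpan,
      Tendsto (fun x => g x - P x - c) (nhdsWithin 0 (Set.Ioi 0)) (nhds 0) := by
  obtain ⟨s, A, hs, hlim⟩ := h
  exact ⟨_, sum_cTerm_mem_nonconstSpan A fun p hp => (hs p hp).2, hlim⟩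

theorem continuousOn_cTerm (p : ℂ × ℕ) : ContinuousOn (CTerm p) (Set.Ioi 0) := by
  intro x hx
  have hx' : (0 : ℝ) < x := hx
  refine ContinuousAt.continuousWithinAt (ContinuousAt.mul ?_ ?_)
  · exact (continuousAt_cpow_const (Complex.ofReal_mem_slitPlane.2 hx')).comp
      Complex.continuous_ofReal.continuousAt
  · exact ((Complex.continuous_ofReal.continuousAt).comp
      (Real.continuousAt_log hx'.ne')).pow _

theorem uIcc_subset_Ioi_zero {a b : ℝ} (ha : 0 < a) (hb : 0 < b) :
    Set.uIcc a b ⊆ Set.Ioi 0 :=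
  fun _ hy => (lt_min ha hb).trans_le hy.1

theorem intervalIntegrable_cTerm (p : ℂ × ℕ) {a b : ℝ} (ha : 0 < a) (hb : 0 < b) :
    IntervalIntegrable (CTerm p) volume a b :=
  ((continuousOn_cTerm p).mono (uIcc_subset_Ioi_zero ha hb)).intervalIntegrable

theorem MeasureTheory.LocallyIntegrableOn.intervalIntegrable_of_pos {f : ℝ → ℂ}
    (hf : LocallyIntegrableOn f (Set.Ioi 0)) {a b : ℝ} (ha : 0 < a) (hb : 0 < b) :
    IntervalIntegrable f volume a b :=
  (hf.integrableOn_compact_subset (uIcc_subset_Ioi_zero ha hb) isCompact_uIcc).intervalIntegrable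

theorem cTerm_mul (p : ℂ × ℕ) {x u : ℝ} (hx : 0 < x) (hu : 0 < u) :
    CTerm p (x * u) = ∑ j ∈ Finset.range (p.2 + 1),
      (p.2.choose j : ℂ) * CTerm (p.1, j) x * CTerm (p.1, p.2 - j) u := by
  simp only [CTerm]
  rw [Complex.ofReal_mul, Complex.mul_cpow_ofReal_nonneg hx.le hu.le,
    Real.log_mul hx.ne' hu.ne', Complex.ofReal_add, add_pow, Finset.mul_sum]
  exact Finset.sum_congr rfl fun j _ => by ring

theorem mul_cTerm (p : ℂ × ℕ) {x : ℝ} (hx : 0 < x) :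
    (x : ℂ) * CTerm p x = CTerm (p.1 + 1, p.2) x := by
  have hne : (x : ℂ) ≠ 0 := by exact_mod_cast hx.ne'
  rw [CTerm, CTerm, Complex.cpow_add _ _ hne, Complex.cpow_one]
  ring

theorem integral_cTerm_mul (p : ℂ × ℕ) {x l : ℝ} (hx : 0 < x) (hl : 0 < l) :
    ∫ y in x..x * l, CTerm p y = ∑ j ∈ Finset.range (p.2 + 1),
      ((p.2.choose j : ℂ) * ∫ u in (1 : ℝ)..l, CTerm (p.1, p.2 - j) u) *
        CTerm (p.1 + 1, j) x := by
  have hsub := intervalIntegral.smul_integral_comp_mul_left (a := 1) (b := l) (CTerm p) x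
  rw [mul_one] at hsub
  have hexp : ∫ u in (1 : ℝ)..l, CTerm p (x * u) = ∑ j ∈ Finset.range (p.2 + 1),
      (p.2.choose j : ℂ) * CTerm (p.1, j) x * ∫ u in (1 : ℝ)..l, CTerm (p.1, p.2 - j) u := by
    rw [intervalIntegral.integral_congr
      fun u hu => cTerm_mul p hx (uIcc_subset_Ioi_zero one_pos hl hu),
      intervalIntegral.integral_finsetSum
      fun j _ => (intervalIntegrable_cTerm _ one_pos hl).const_mul _]
    exact Finset.sum_congr rfl fun j _ => intervalIntegral.integral_const_mul _ _
  rw [← hsub, hexp, Complex.real_smul, Finset.mul_sum]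
  refine Finset.sum_congr rfl fun j _ => ?_
  rw [← mul_cTerm (p.1, j) hx]
  ring

open Classical in
theorem exists_integral_cTerm_eq (p : ℂ × ℕ) (hp : ¬(p.1 = -1 ∧ 1 ≤ p.2)) {l : ℝ} (hl : 0 < l) :
    ∃ P ∈ nonconstSpan, ∀ x : ℝ, 0 < x →
      ∫ y in x..x * l, CTerm p y = P x + if p = (-1, 0) then (Real.log l : ℂ) else 0 := by
  by_cases hp1 : p = (-1, 0)
  · refine ⟨0, Submodule.zero_mem _, fun x hx => ?_⟩
    have hinv : ∀ y : ℝ, CTerm (-1, 0) y = ((y⁻¹ : ℝ) : ℂ) := fun y => by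
      simp [CTerm, Complex.cpow_neg_one]
    simp only [hp1, hinv, if_true, Pi.zero_apply, zero_add]
    rw [intervalIntegral.integral_ofReal, integral_inv_of_pos hx (mul_pos hx hl),
      mul_div_cancel_left₀ _ hx.ne']
  · refine ⟨_, sum_cTerm_mem_nonconstSpan (s := (Finset.range (p.2 + 1)).image (p.1 + 1, ·))
      (fun q => (p.2.choose q.2 : ℂ) * ∫ u in (1 : ℝ)..l, CTerm (p.1, p.2 - q.2) u) ?_,
      fun x hx => ?_⟩
    · simp only [Finset.mem_image, forall_exists_index, and_imp]
      rintro q j - rfl hq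
      have hp' : p.1 = -1 := eq_neg_of_add_eq_zero_left (congrArg Prod.fst hq)
      exact hp1 (Prod.ext hp' (by_contra fun h => hp ⟨hp', Nat.one_le_iff_ne_zero.2 h⟩))
    · rw [if_neg hp1, add_zero, integral_cTerm_mul p hx hl,
        Finset.sum_image fun i _ j _ hij => congrArg Prod.snd hij]

theorem exists_integral_sum_cTerm_eq {s : Finset (ℂ × ℕ)} (A : ℂ × ℕ → ℂ)
    (hs : ∀ p ∈ s, ¬(p.1 = -1 ∧ 1 ≤ p.2)) {a : ℂ}
    (ha : (((-1 : ℂ), 0) ∈ s → a = A (-1, 0)) ∧ (((-1 : ℂ), 0) ∉ s → a = 0))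
    {l : ℝ} (hl : 0 < l) :
    ∃ P ∈ nonconstSpan, ∀ x : ℝ, 0 < x →
      ∫ y in x..x * l, ∑ p ∈ s, A p * CTerm p y = P x + a * Real.log l := by
  classical
  choose! P hP hPint using fun p hp => exists_integral_cTerm_eq p (hs p hp) hl
  refine ⟨∑ p ∈ s, A p • P p,
    Submodule.sum_mem _ fun p hp => Submodule.smul_mem _ _ (hP p hp), fun x hx => ?_⟩
  rw [intervalIntegral.integral_finsetSum
    fun p _ => (intervalIntegrable_cTerm p hx (mul_pos hx hl)).const_mul _]
  have ha' : a * Real.log l =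
      ∑ p ∈ s, A p * if p = (-1, 0) then (Real.log l : ℂ) else 0 := by
    simp only [mul_ite, mul_zero, Finset.sum_ite_eq']
    split_ifs with h
    · rw [ha.1 h]
    · rw [ha.2 h, zero_mul]
  rw [ha', Finset.sum_apply, ← Finset.sum_add_distrib]
  refine Finset.sum_congr rfl fun p hp => ?_
  rw [intervalIntegral.integral_const_mul, hPint p hp x hx, Pi.smul_apply, smul_eq_mul, mul_add]

theorem tendsto_integral_mul_of_isBigO_rpow {L : Filter ℝ} {r : ℝ → ℂ} {b l : ℝ} (hl : 0 < l)
    (hpos : ∀ᶠ x in L, 0 < x)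
    (hunif : ∀ q : ℝ → Prop, (∀ᶠ y in L, q y) → ∀ᶠ x in L, ∀ u ∈ Set.uIcc 1 l, q (x * u))
    (hb : Tendsto (fun x : ℝ => x ^ (b + 1)) L (nhds 0))
    (hr : r =O[L] fun x : ℝ => x ^ b) :
    Tendsto (fun x => ∫ y in x..x * l, r y) L (nhds 0) := by
  obtain ⟨C, hC⟩ := hr.bound
  obtain ⟨M, hM⟩ : ∃ M, ∀ u ∈ Set.uIcc 1 l, ‖u ^ b‖ ≤ M :=
    isCompact_uIcc.exists_bound_of_continuousOn fun u hu =>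
      (Real.continuousAt_rpow_const u b
        (Or.inl (uIcc_subset_Ioi_zero one_pos hl hu).ne')).continuousWithinAt
  refine squeeze_zero_norm' (a := fun x => |C| * M * |l - 1| * x ^ (b + 1)) ?_
    (by simpa using hb.const_mul (|C| * M * |l - 1|))
  filter_upwards [hpos, hunif _ hC] with x hx hxu
  have hsub := intervalIntegral.smul_integral_comp_mul_left (a := 1) (b := l) r x
  rw [mul_one] at hsub
  have hle : ‖∫ u in (1 : ℝ)..l, r (x * u)‖ ≤ (|C| * (x ^ b * M)) * |l - 1| := by
    refine intervalIntegral.norm_integral_le_of_norm_le_const fun u hu => ?_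
    have hu' := Set.uIoc_subset_uIcc hu
    have hupos : 0 < u := uIcc_subset_Ioi_zero one_pos hl hu'
    refine (hxu u hu').trans ?_
    rw [Real.mul_rpow hx.le hupos.le, norm_mul, Real.norm_of_nonneg (Real.rpow_nonneg hx.le b)]
    have := hM u hu'
    gcongr
    exact le_abs_self C
  rw [← hsub, norm_smul, Real.norm_of_nonneg hx.le, Real.rpow_add_one hx.ne']
  calc x * ‖∫ u in (1 : ℝ)..l, r (x * u)‖ ≤ x * ((|C| * (x ^ b * M)) * |l - 1|) := by gcongr
    _ = _ := by ring

theorem eventually_atTop_forall_uIcc_mul {l : ℝ} (hl : 0 < l) (q : ℝ → Prop)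
    (hq : ∀ᶠ y in atTop, q y) : ∀ᶠ x in atTop, ∀ u ∈ Set.uIcc 1 l, q (x * u) := by
  obtain ⟨N, hN⟩ := eventually_atTop.1 hq
  have hm : 0 < min 1 l := lt_min one_pos hl
  filter_upwards [eventually_ge_atTop (N / min 1 l), eventually_gt_atTop 0] with x hx hx0 u hu
  refine hN _ (((div_le_iff₀ hm).1 hx).trans ?_)
  exact mul_le_mul_of_nonneg_left hu.1 hx0.le

theorem eventually_nhdsGT_zero_forall_uIcc_mul {l : ℝ} (hl : 0 < l) (q : ℝ → Prop)
    (hq : ∀ᶠ y in nhdsWithin 0 (Set.Ioi 0), q y) :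
    ∀ᶠ x in nhdsWithin 0 (Set.Ioi 0), ∀ u ∈ Set.uIcc 1 l, q (x * u) := by
  obtain ⟨d, hd, hdq⟩ := mem_nhdsGT_iff_exists_Ioo_subset.1 hq
  have hm : 0 < max 1 l := one_pos.trans_le (le_max_left _ _)
  filter_upwards [Ioo_mem_nhdsGT (div_pos hd hm)] with x hx u hu
  refine hdq ⟨mul_pos hx.1 (uIcc_subset_Ioi_zero one_pos hl hu), ?_⟩
  exact (mul_le_mul_of_nonneg_left hu.2 hx.1.le).trans_lt ((lt_div_iff₀ hm).1 hx.2)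

/-- The effect of rescaling on the regularized limit, along a filter `L`, of the primitive
`x ↦ ∫ y in 1..x, f y`. -/
theorem regLim_primitive_rescale {L : Filter ℝ} {f : ℝ → ℂ}
    (hloc : LocallyIntegrableOn f (Set.Ioi 0)) {s : Finset (ℂ × ℕ)} {A : ℂ × ℕ → ℂ} {b l : ℝ}
    (hl : 0 < l) (hpos : ∀ᶠ x in L, 0 < x)
    (hunif : ∀ q : ℝ → Prop, (∀ᶠ y in L, q y) → ∀ᶠ x in L, ∀ u ∈ Set.uIcc 1 l, q (x * u))
    (hb : Tendsto (fun x : ℝ => x ^ (b + 1)) L (nhds 0))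
    (huniq : ∀ P ∈ nonconstSpan, ∀ c : ℂ, Tendsto (fun x => P x + c) L (nhds 0) → c = 0)
    (hs : ∀ p ∈ s, ¬(p.1 = -1 ∧ 1 ≤ p.2))
    (hexp : (fun x : ℝ => f x - ∑ p ∈ s, A p * CTerm p x) =O[L] fun x : ℝ => x ^ b) {a : ℂ}
    (ha : (((-1 : ℂ), 0) ∈ s → a = A (-1, 0)) ∧ (((-1 : ℂ), 0) ∉ s → a = 0))
    {P P' : ℝ → ℂ} (hP : P ∈ nonconstSpan) (hP' : P' ∈ nonconstSpan) {v v' : ℂ}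
    (hv : Tendsto (fun x => (∫ y in (1 : ℝ)..x, f y) - P x - v) L (nhds 0))
    (hv' : Tendsto (fun x => (∫ y in (1 : ℝ)..x, f (l * y)) - P' x - v') L (nhds 0)) :
    (l : ℂ) * v' + (∫ y in (1 : ℝ)..l, f y) - v = a * Real.log l := by
  obtain ⟨D, hD, hDint⟩ := exists_integral_sum_cTerm_eq A hs ha hl
  have hrem := tendsto_integral_mul_of_isBigO_rpow hl hpos hunif hb hexp
  refine sub_eq_zero.1 (huniq ((l : ℂ) • P' - P - D)
    (Submodule.sub_mem _ (Submodule.sub_mem _ (Submodule.smul_mem _ _ hP') hP) hD) _ ?_)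
  have hlim := (hrem.add hv).sub (hv'.const_mul (l : ℂ))
  simp only [mul_zero, sub_zero, add_zero] at hlim
  refine hlim.congr' ?_
  filter_upwards [hpos] with x hx
  have hxl : 0 < x * l := mul_pos hx hl
  have hscale := intervalIntegral.smul_integral_comp_mul_left (a := 1) (b := x) f l
  rw [mul_one, Complex.real_smul, mul_comm l x] at hscale
  have hadd₁ := intervalIntegral.integral_add_adjacent_intervals
    (hloc.intervalIntegrable_of_pos one_pos hl) (hloc.intervalIntegrable_of_pos hl hxl)
  have hadd₂ := intervalIntegral.integral_add_adjacent_intervals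
    (hloc.intervalIntegrable_of_pos one_pos hx) (hloc.intervalIntegrable_of_pos hx hxl)
  have hsumint : IntervalIntegrable (fun y => ∑ p ∈ s, A p * CTerm p y) volume x (x * l) := by
    refine ContinuousOn.intervalIntegrable ?_
    exact continuousOn_finsetSum _ fun p _ => continuousOn_const.mul
      ((continuousOn_cTerm p).mono (uIcc_subset_Ioi_zero hx hxl))
  rw [intervalIntegral.integral_sub (hloc.intervalIntegrable_of_pos hx hxl) hsumint,
    hDint x hx]
  simp only [Pi.sub_apply, Pi.smul_apply, smul_eq_mul]
  linear_combination hadd₂ - hadd₁ - hscale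

/-- Change of variables for regularized integrals (Lemma 2.1 / `LChangeVar`). -/
theorem stmt_2 (f : ℝ → ℂ) (hloc : LocallyIntegrableOn f (Set.Ioi 0))
    (sInf s0 : Finset (ℂ × ℕ)) (AInf A0 : ℂ × ℕ → ℂ) (δ : ℝ) (hδ : 0 < δ)
    -- no terms `x⁻¹ log^k x` with `k ≥ 1` in either expansion:
    (hsInf : ∀ p ∈ sInf, ¬(p.1 = -1 ∧ 1 ≤ p.2))
    (hs0 : ∀ p ∈ s0, ¬(p.1 = -1 ∧ 1 ≤ p.2))
    -- asymptotic expansion of `f` at `∞` and at `0⁺`: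
    (hexpInf : (fun x : ℝ => f x - ∑ p ∈ sInf, AInf p * CTerm p x)
        =O[atTop] fun x : ℝ => x ^ (-1 - δ))
    (hexp0 : (fun x : ℝ => f x - ∑ p ∈ s0, A0 p * CTerm p x)
        =O[nhdsWithin 0 (Set.Ioi 0)] fun x : ℝ => x ^ (-1 + δ))
    -- the coefficients of `x⁻¹` at `∞` and at `0`:
    (aInf a0 : ℂ)
    (haInf : (((-1 : ℂ), 0) ∈ sInf → aInf = AInf (-1, 0)) ∧ (((-1 : ℂ), 0) ∉ sInf → aInf = 0))
    (ha0 : (((-1 : ℂ), 0) ∈ s0 → a0 = A0 (-1, 0)) ∧ (((-1 : ℂ), 0) ∉ s0 → a0 = 0))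
    (l : ℝ) (hl : 0 < l) (c c' : ℂ)
    (hc : HasRegInt f 0 c) (hc' : HasRegInt (fun x => f (l * x)) 0 c') :
    c = (l : ℂ) * c' - aInf * Real.log l + a0 * Real.log l := by
  obtain ⟨h, -⟩ | ⟨-, v₀, v₁, h₀, h₁, rfl⟩ := hc
  · exact absurd rfl h
  obtain ⟨h, -⟩ | ⟨-, w₀, w₁, k₀, k₁, rfl⟩ := hc'
  · exact absurd rfl h
  obtain ⟨P₀, hP₀, hv₀⟩ := h₀.exists_nonconstSpan
  obtain ⟨P₁, hP₁, hv₁⟩ := h₁.exists_nonconstSpan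
  obtain ⟨R₀, hR₀, hw₀⟩ := k₀.exists_nonconstSpan
  obtain ⟨R₁, hR₁, hw₁⟩ := k₁.exists_nonconstSpan
  have hTop := regLim_primitive_rescale hloc hl (eventually_gt_atTop 0)
    (eventually_atTop_forall_uIcc_mul hl)
    ((tendsto_rpow_neg_atTop hδ).congr fun x => by ring_nf)
    (fun P hP c => eq_zero_of_tendsto_nonconstSpan_atTop hP) hsInf hexpInf haInf hP₁ hR₁ hv₁ hw₁
  have hδ0 : Tendsto (fun x : ℝ => x ^ (-1 + δ + 1)) (nhdsWithin 0 (Set.Ioi 0)) (nhds 0) := by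
    have h := (Real.continuousAt_rpow_const 0 δ (Or.inr hδ.le)).tendsto
    rw [Real.zero_rpow hδ.ne'] at h
    exact (h.mono_left nhdsWithin_le_nhds).congr fun x => by ring_nf
  have hneg : ∀ {g P : ℝ → ℂ} {v : ℂ},
      Tendsto (fun e => (∫ x in e..1, g x) - P e - v) (nhdsWithin 0 (Set.Ioi 0)) (nhds 0) →
      Tendsto (fun e => (∫ x in (1 : ℝ)..e, g x) - (-P) e - -v)
        (nhdsWithin 0 (Set.Ioi 0)) (nhds 0) := fun {g P v} h => by
    refine (neg_zero (G := ℂ) ▸ h.neg).congr fun e => ?_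
    rw [intervalIntegral.integral_symm 1 e, Pi.neg_apply]
    ring
  have hZero := regLim_primitive_rescale hloc hl self_mem_nhdsWithin
    (eventually_nhdsGT_zero_forall_uIcc_mul hl) hδ0
    (fun P hP c => eq_zero_of_tendsto_nonconstSpan_nhdsGT_zero hP) hs0 hexp0 ha0
    (Submodule.neg_mem _ hP₀) (Submodule.neg_mem _ hR₀) (hneg hv₀) (hneg hw₀)
  linear_combination hZero - hTop
end

section
/- Euler–Maclaurin formula for regularized sums: Let f : [1,∞) → ℂ be smooth with an asymptotic expansion of partie-finie type as x → ∞ (remainder O(x^{-1-δ})) which may be differentiated 2M+1 times, where 2M > Re(α_1). Then the regularized sum Σ-reg_{λ=1}^∞ f(λ) equals ⨍_1^∞ f(x) dx + Σ_{k=1}^M (B_{2k}/(2k)!) (LIM_{N→∞} f^{(2k-1)}(N) - f^{(2k-1)}(1)) + (1/2) f(1) + (1/2) LIM_{N→∞} f(N) + (1/(2M+1)!) ∫_1^∞ B_{2M+1}(x - ⌊x⌋) f^{(2M+1)}(x) dx. -/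
open MeasureTheory Filter Asymptotics

open Topology

/-- Distinct real frequencies give distinct characters `m ↦ m ^ (β i)` of the positive integers. -/
lemma exists_natCast_cpow_ne {β γ : ℝ} (h : β ≠ γ) :
    ∃ m : ℕ, m ≠ 0 ∧ (m : ℂ) ^ (β * Complex.I) ≠ (m : ℂ) ^ (γ * Complex.I) := by
  by_contra! hcon
  have hd : β - γ ≠ 0 := sub_ne_zero.mpr h
  have hper : ∀ m : ℕ, m ≠ 0 → Complex.exp (((β - γ) * Real.log m : ℝ) * Complex.I) = 1 := by
    intro m hm
    have hm' : (m : ℂ) ≠ 0 := by exact_mod_cast hm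
    have h1 := hcon m hm
    rw [Complex.cpow_def_of_ne_zero hm', Complex.cpow_def_of_ne_zero hm',
      ← Complex.natCast_log] at h1
    have h2 : (((β - γ) * Real.log m : ℝ) * Complex.I : ℂ)
        = (Real.log m : ℂ) * (β * Complex.I) - (Real.log m : ℂ) * (γ * Complex.I) := by
      push_cast; ring
    rw [h2, Complex.exp_sub, h1, div_self (Complex.exp_ne_zero _)]
  have hlim : Tendsto (fun m : ℕ => (β - γ) * Real.log (1 + 1 / (m : ℝ))) atTop (𝓝 0) := by
    have h1 : Tendsto (fun m : ℕ => 1 + 1 / (m : ℝ)) atTop (𝓝 (1 + 0)) :=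
      tendsto_const_nhds.add tendsto_one_div_atTop_nhds_zero_nat
    have h2 := (h1.log (by norm_num)).const_mul (β - γ)
    simpa using h2
  have hsmall : ∀ᶠ m : ℕ in atTop, |(β - γ) * Real.log (1 + 1 / (m : ℝ))| < 2 * Real.pi := by
    have := hlim.abs
    rw [abs_zero] at this
    exact this.eventually_lt_const Real.two_pi_pos
  obtain ⟨m, hm, hm0⟩ := (hsmall.and (eventually_gt_atTop 0)).exists
  have hmR : (0 : ℝ) < m := by exact_mod_cast hm0
  have hlog : Real.log (1 + 1 / (m : ℝ)) = Real.log ((m + 1 : ℕ) : ℝ) - Real.log m := by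
    rw [← Real.log_div (by positivity) hmR.ne']
    congr 1
    push_cast
    field_simp
  have hexp : Complex.exp (((β - γ) * Real.log (1 + 1 / (m : ℝ)) : ℝ) * Complex.I) = 1 := by
    have h2 : ((((β - γ) * Real.log (1 + 1 / (m : ℝ)) : ℝ)) * Complex.I : ℂ)
        = (((β - γ) * Real.log ((m + 1 : ℕ) : ℝ) : ℝ)) * Complex.I
          - (((β - γ) * Real.log m : ℝ)) * Complex.I := by
      rw [hlog]; push_cast; ring
    rw [h2, Complex.exp_sub, hper _ (by omega), hper _ hm0.ne', div_one]
  obtain ⟨n, hn⟩ := Complex.exp_eq_one_iff.mp hexp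
  have hn' : (β - γ) * Real.log (1 + 1 / (m : ℝ)) = n * (2 * Real.pi) := by
    have := congrArg Complex.im hn
    simpa using this
  have hpos : (β - γ) * Real.log (1 + 1 / (m : ℝ)) ≠ 0 :=
    mul_ne_zero hd (Real.log_pos (by simp [hmR])).ne'
  have hn0 : n ≠ 0 := by
    rintro rfl
    exact hpos (by rw [hn', Int.cast_zero, zero_mul])
  have h1 : (1 : ℝ) ≤ |(n : ℝ)| := by exact_mod_cast Int.one_le_abs hn0
  rw [hn', abs_mul, abs_of_pos Real.two_pi_pos] at hm
  nlinarith [Real.two_pi_pos]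

/-- An oscillating sum `∑ a i * N ^ (β i * I)` with distinct frequencies tends to zero along the
integers only if it vanishes. -/
lemma eq_zero_of_tendsto_sum_cpow_mul_I {ι : Type*} (s : Finset ι) (β : ι → ℝ)
    (hβ : Set.InjOn β s) (a : ι → ℂ)
    (h : Tendsto (fun N : ℕ => ∑ i ∈ s, a i * (N : ℂ) ^ (β i * Complex.I)) atTop (𝓝 0)) :
    ∀ i ∈ s, a i = 0 := by
  classical
  induction s using Finset.induction_on generalizing a with
  | empty => simp
  | insert j s hj ih =>
    have hrest : ∀ i ∈ s, a i = 0 := by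
      intro i hi
      have hij : β i ≠ β j := fun heq => hj <| by
        have := hβ (Finset.mem_insert_of_mem hi) (Finset.mem_insert_self j s) heq
        exact this ▸ hi
      obtain ⟨m, hm0, hm⟩ := exists_natCast_cpow_ne hij
      have hmul : Tendsto (fun N : ℕ => m * N) atTop atTop :=
        tendsto_id.const_mul_atTop' (Nat.pos_of_ne_zero hm0)
      have hdiff := (h.comp hmul).sub (h.const_mul ((m : ℂ) ^ (β j * Complex.I)))
      rw [mul_zero, sub_zero] at hdiff
      have := ih (hβ.mono (by simp)) (fun i => a i * ((m : ℂ) ^ (β i * Complex.I) -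
        (m : ℂ) ^ (β j * Complex.I))) (hdiff.congr fun N => ?_) i hi
      · exact (mul_eq_zero.mp this).resolve_right (sub_ne_zero.mpr hm)
      · simp only [Function.comp_apply, Nat.cast_mul, Complex.natCast_mul_natCast_cpow,
          Finset.sum_insert hj, mul_add, Finset.mul_sum]
        rw [add_sub_add_comm, ← Finset.sum_sub_distrib]
        rw [show a j * ((m : ℂ) ^ (β j * Complex.I) * (N : ℂ) ^ (β j * Complex.I)) -
          (m : ℂ) ^ (β j * Complex.I) * (a j * (N : ℂ) ^ (β j * Complex.I)) = 0 by ring, zero_add]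
        exact Finset.sum_congr rfl fun i _ => by ring
    have hj0 : a j = 0 := by
      have h1 : Tendsto (fun N : ℕ => ‖a j‖) atTop (𝓝 0) := by
        have h2 := h.norm
        rw [norm_zero] at h2
        refine h2.congr' ?_
        filter_upwards [eventually_gt_atTop 0] with N hN
        rw [Finset.sum_insert hj, Finset.sum_eq_zero (fun i hi => by rw [hrest i hi, zero_mul]),
          add_zero, norm_mul, Complex.norm_natCast_cpow_of_pos hN]
        simp
      exact norm_eq_zero.mp (tendsto_nhds_unique tendsto_const_nhds h1)
    intro i hi
    rcases Finset.mem_insert.mp hi with rfl | hi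
    · exact hj0
    · exact hrest i hi

lemma norm_CTerm (p : ℂ × ℕ) {x : ℝ} (hx : 0 < x) :
    ‖CTerm p x‖ = x ^ p.1.re * |Real.log x| ^ p.2 := by
  rw [CTerm, norm_mul, norm_pow, Complex.norm_cpow_eq_rpow_re_of_pos hx, Complex.norm_real,
    Real.norm_eq_abs]

lemma isLittleO_CTerm_rpow {p : ℂ × ℕ} {ρ : ℝ} (h : p.1.re < ρ) :
    CTerm p =o[atTop] fun x : ℝ => x ^ ρ := by
  have h1 := (isLittleO_log_rpow_rpow_atTop (p.2 : ℝ) (sub_pos.mpr h))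
  have h2 := (isBigO_refl (fun x : ℝ => x ^ p.1.re) atTop).mul_isLittleO h1
  refine ((IsLittleO.congr' h2 EventuallyEq.rfl ?_).norm_left.congr' ?_
    EventuallyEq.rfl).of_norm_left
  · filter_upwards [eventually_gt_atTop 0] with x hx
    rw [← Real.rpow_add hx]; congr 1; ring
  · filter_upwards [eventually_gt_atTop 0] with x hx
    rw [norm_CTerm p hx, Real.rpow_natCast, norm_mul, norm_pow,
      Real.norm_of_nonneg (Real.rpow_nonneg hx.le _), Real.norm_eq_abs]

lemma isLittleO_sum_CTerm_rpow {s : Finset (ℂ × ℕ)} (A : ℂ × ℕ → ℂ) {ρ : ℝ}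
    (h : ∀ p ∈ s, A p ≠ 0 → p.1.re < ρ) :
    (fun x => ∑ p ∈ s, A p * CTerm p x) =o[atTop] fun x : ℝ => x ^ ρ := by
  refine IsLittleO.fun_sum fun p hp => ?_
  by_cases hA : A p = 0
  · simp only [hA, zero_mul]
    exact isLittleO_zero _ _
  · exact (isLittleO_CTerm_rpow (h p hp hA)).const_mul_left _

lemma isBigO_rpow_rpow_atTop {a b : ℝ} (h : a ≤ b) :
    (fun x : ℝ => x ^ a) =O[atTop] fun x : ℝ => x ^ b := by
  refine IsBigO.of_bound' ?_
  filter_upwards [eventually_ge_atTop 1] with x hx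
  rw [Real.norm_of_nonneg (by positivity), Real.norm_of_nonneg (by positivity)]
  exact Real.rpow_le_rpow_of_exponent_le hx h

lemma isLittleO_rpow_rpow_atTop {a b : ℝ} (h : a < b) :
    (fun x : ℝ => x ^ a) =o[atTop] fun x : ℝ => x ^ b := by
  refine isLittleO_of_tendsto' ?_ ((tendsto_rpow_neg_atTop (sub_pos.mpr h)).congr' ?_)
  · filter_upwards [eventually_gt_atTop 0] with x hx h0
    exact absurd h0 (Real.rpow_pos_of_pos hx b).ne'
  · filter_upwards [eventually_gt_atTop 0] with x hx
    rw [← Real.rpow_sub hx, neg_sub]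

/-- The terms `x ^ α * (log x) ^ k` with `Re α ≥ ρ` are linearly independent modulo `o(x ^ ρ)`,
even along the integers. -/
lemma eq_zero_of_tendsto_sum_CTerm (s : Finset (ℂ × ℕ)) (A : ℂ × ℕ → ℂ) (ρ : ℝ)
    (hs : ∀ p ∈ s, ρ ≤ p.1.re)
    (h : Tendsto (fun N : ℕ => (((N : ℝ) ^ (-ρ) : ℝ) : ℂ) * ∑ p ∈ s, A p * CTerm p (N : ℝ))
      atTop (𝓝 0)) :
    ∀ p ∈ s, A p = 0 := by
  classical
  by_contra! hne
  obtain ⟨q, hq, hAq⟩ := hne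
  have hmemt : ∀ p, p ∈ s.filter (fun p => A p ≠ 0) ↔ p ∈ s ∧ A p ≠ 0 := fun p =>
    Finset.mem_filter
  obtain ⟨p₀, hp₀, hmax⟩ := (s.filter fun p => A p ≠ 0).exists_max_image
    (fun p => toLex (p.1.re, p.2)) ⟨q, (hmemt q).mpr ⟨hq, hAq⟩⟩
  obtain ⟨hp₀s, hAp₀⟩ := (hmemt p₀).mp hp₀
  set r := p₀.1.re with hr
  set K := p₀.2 with hK
  set w : ℕ → ℝ := fun N => (N : ℝ) ^ (-r) * (Real.log N ^ K)⁻¹ with hw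
  have hlog : Tendsto (fun N : ℕ => Real.log N) atTop atTop :=
    Real.tendsto_log_atTop.comp tendsto_natCast_atTop_atTop
  have hscaled : Tendsto (fun N : ℕ => (w N : ℂ) * ∑ p ∈ s, A p * CTerm p (N : ℝ))
      atTop (𝓝 0) := by
    refine squeeze_zero_norm' ?_ (tendsto_zero_iff_norm_tendsto_zero.mp h)
    filter_upwards [eventually_ge_atTop 1, hlog.eventually_ge_atTop 1] with N hN hlN
    have hN1 : (1 : ℝ) ≤ N := by exact_mod_cast hN
    rw [norm_mul, norm_mul]
    gcongr
    rw [Complex.norm_real, Complex.norm_real, Real.norm_of_nonneg (by positivity),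
      Real.norm_of_nonneg (by positivity), hw]
    calc (N : ℝ) ^ (-r) * (Real.log N ^ K)⁻¹ ≤ (N : ℝ) ^ (-r) * 1 := by
          gcongr
          exact inv_le_one_of_one_le₀ (one_le_pow₀ hlN)
      _ ≤ (N : ℝ) ^ (-ρ) := by
          rw [mul_one]
          exact Real.rpow_le_rpow_of_exponent_le hN1 (by linarith [hs p₀ hp₀s])
  set u := (s.filter fun p => A p ≠ 0).filter fun p => p.1.re = r ∧ p.2 = K with hu
  have hlower : ∀ p ∈ (s.filter fun p => A p ≠ 0), p ∉ u →
      Tendsto (fun N : ℕ => (w N : ℂ) * CTerm p (N : ℝ)) atTop (𝓝 0) := by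
    intro p hp hpu
    have hle := hmax p hp
    rw [Prod.Lex.toLex_le_toLex] at hle
    rcases hle with hlt | ⟨heq, hk⟩
    · have h1 : Tendsto (fun N : ℕ => ‖CTerm p (N : ℝ)‖ / (N : ℝ) ^ r) atTop (𝓝 0) :=
        ((isLittleO_CTerm_rpow hlt).norm_left.tendsto_div_nhds_zero).comp
          tendsto_natCast_atTop_atTop
      refine squeeze_zero_norm' ?_ h1
      filter_upwards [eventually_ge_atTop 1, hlog.eventually_ge_atTop 1] with N hN hlN
      have hN1 : (1 : ℝ) ≤ N := by exact_mod_cast hN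
      rw [norm_mul, Complex.norm_real, Real.norm_of_nonneg (by positivity), hw]
      simp only
      rw [Real.rpow_neg (by positivity), div_eq_mul_inv, mul_comm]
      gcongr
      exact mul_le_of_le_one_right (by positivity) (inv_le_one_of_one_le₀ (one_le_pow₀ hlN))
    · simp only at heq hk
      have hkK : p.2 < K := lt_of_le_of_ne hk fun h => hpu <| by
        rw [hu, Finset.mem_filter]; exact ⟨hp, heq, h⟩
      have h1 : Tendsto (fun N : ℕ => (Real.log N)⁻¹) atTop (𝓝 0) := hlog.inv_tendsto_atTop
      refine squeeze_zero_norm' ?_ h1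
      filter_upwards [eventually_ge_atTop 1, hlog.eventually_ge_atTop 1] with N hN hlN
      have hN0 : (0 : ℝ) < N := by exact_mod_cast hN
      have hl0 : 0 < Real.log N := by linarith
      rw [norm_mul, Complex.norm_real, Real.norm_of_nonneg (by positivity), norm_CTerm _ hN0, heq,
        abs_of_pos hl0]
      have h2 : w N * ((N : ℝ) ^ r * Real.log N ^ p.2) = (Real.log N ^ K)⁻¹ * Real.log N ^ p.2 := by
        have h3 : (N : ℝ) ^ (-r) * (N : ℝ) ^ r = 1 := by
          rw [← Real.rpow_add hN0, neg_add_cancel, Real.rpow_zero]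
        calc _ = ((N : ℝ) ^ (-r) * (N : ℝ) ^ r) * ((Real.log N ^ K)⁻¹ * Real.log N ^ p.2) := by
              rw [hw]; ring
          _ = _ := by rw [h3, one_mul]
      rw [h2, inv_mul_le_iff₀ (by positivity), ← div_eq_mul_inv, le_div_iff₀ hl0, ← pow_succ]
      exact pow_le_pow_right₀ hlN hkK
  have hosc : Tendsto (fun N : ℕ => ∑ p ∈ u, A p * (N : ℂ) ^ (p.1.im * Complex.I))
      atTop (𝓝 0) := by
    have hrest : Tendsto (fun N : ℕ => ∑ p ∈ (s.filter fun p => A p ≠ 0) \ u,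
        A p * ((w N : ℂ) * CTerm p (N : ℝ))) atTop (𝓝 0) := by
      have h0 := tendsto_finsetSum ((s.filter fun p => A p ≠ 0) \ u) fun p hp =>
        (hlower p (Finset.mem_sdiff.mp hp).1 (Finset.mem_sdiff.mp hp).2).const_mul (A p)
      simpa only [mul_zero, Finset.sum_const_zero] using h0
    have hd := hscaled.sub hrest
    rw [sub_zero] at hd
    refine hd.congr' ?_
    filter_upwards [eventually_ge_atTop 1, hlog.eventually_ge_atTop 1] with N hN hlN
    have hN0 : (0 : ℝ) < N := by exact_mod_cast hN
    have hl0 : 0 < Real.log N := by linarith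
    have h1 : ∑ p ∈ s, A p * CTerm p (N : ℝ)
        = ∑ p ∈ s.filter (fun p => A p ≠ 0), A p * CTerm p (N : ℝ) := by
      refine (Finset.sum_filter_of_ne fun p _ hp => ?_).symm
      exact left_ne_zero_of_mul hp
    rw [h1, Finset.mul_sum, ← Finset.sum_sdiff (Finset.filter_subset _ _ : u ⊆ _)]
    rw [Finset.sum_congr rfl fun p _ => show (w N : ℂ) * (A p * CTerm p (N : ℝ))
      = A p * ((w N : ℂ) * CTerm p (N : ℝ)) by ring, add_sub_cancel_left]
    refine Finset.sum_congr rfl fun p hp => ?_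
    obtain ⟨-, hpr, hpK⟩ := Finset.mem_filter.mp hp
    have hNC : (N : ℂ) ≠ 0 := by exact_mod_cast hN0.ne'
    have hlC : (Real.log N : ℂ) ≠ 0 := by exact_mod_cast hl0.ne'
    rw [mul_left_comm, hw, CTerm, hpK]
    congr 1
    simp only [Complex.ofReal_mul, Complex.ofReal_inv, Complex.ofReal_pow,
      Complex.ofReal_cpow hN0.le, Complex.ofReal_natCast]
    rw [show (N : ℂ) ^ ((-r : ℝ) : ℂ) * ((Real.log N : ℂ) ^ K)⁻¹ * ((N : ℂ) ^ p.1 *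
      (Real.log N : ℂ) ^ K) = (N : ℂ) ^ ((-r : ℝ) : ℂ) * (N : ℂ) ^ p.1 *
        (((Real.log N : ℂ) ^ K)⁻¹ * (Real.log N : ℂ) ^ K) by ring,
      inv_mul_cancel₀ (pow_ne_zero _ hlC), mul_one, ← Complex.cpow_add _ _ hNC]
    congr 1
    apply Complex.ext <;> simp [hpr]
  refine hAp₀ (eq_zero_of_tendsto_sum_cpow_mul_I u (fun p => p.1.im) ?_ A hosc p₀ ?_)
  · intro p hp q hq hpq
    obtain ⟨-, hp1, hp2⟩ := Finset.mem_filter.mp hp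
    obtain ⟨-, hq1, hq2⟩ := Finset.mem_filter.mp hq
    exact Prod.ext (Complex.ext (hp1.trans hq1.symm) hpq) (hp2.trans hq2.symm)
  · exact Finset.mem_filter.mpr ⟨hp₀, rfl, rfl⟩

/-- If a finite sum of terms `x ^ α * (log x) ^ k` is `O(x ^ ρ)`, then the coefficients with
`Re α > ρ` vanish. -/
lemma eq_zero_of_isBigO_sum_CTerm {s : Finset (ℂ × ℕ)} {A : ℂ × ℕ → ℂ} {ρ : ℝ}
    (h : (fun x => ∑ p ∈ s, A p * CTerm p x) =O[atTop] fun x : ℝ => x ^ ρ)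
    {p : ℂ × ℕ} (hp : p ∈ s) (hpρ : ρ < p.1.re) : A p = 0 := by
  classical
  obtain ⟨σ, hσ1, hσ2⟩ := exists_between hpρ
  refine eq_zero_of_tendsto_sum_CTerm (s.filter fun q => σ ≤ q.1.re) A σ
    (fun q hq => (Finset.mem_filter.mp hq).2) ?_ p (Finset.mem_filter.mpr ⟨hp, hσ2.le⟩)
  have hlow : (fun x => ∑ q ∈ s.filter (fun q => ¬ σ ≤ q.1.re), A q * CTerm q x)
      =o[atTop] fun x : ℝ => x ^ σ :=
    isLittleO_sum_CTerm_rpow A fun q hq _ => not_le.mp (Finset.mem_filter.mp hq).2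
  have hρσ : (fun x : ℝ => x ^ ρ) =o[atTop] fun x : ℝ => x ^ σ :=
    isLittleO_rpow_rpow_atTop hσ1
  have hhigh := (h.trans_isLittleO hρσ).sub hlow
  have h1 := (hhigh.norm_left.tendsto_div_nhds_zero).comp (tendsto_natCast_atTop_atTop (R := ℝ))
  refine squeeze_zero_norm' ?_ h1
  filter_upwards [eventually_ge_atTop 1] with N hN
  have hN0 : (0 : ℝ) < N := by exact_mod_cast hN
  rw [Function.comp_apply, norm_mul, Complex.norm_real, Real.norm_of_nonneg (by positivity),
    Real.rpow_neg hN0.le, div_eq_inv_mul]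
  refine le_of_eq ?_
  congr 2
  rw [eq_sub_iff_add_eq, Finset.sum_filter_add_sum_filter_not]

lemma hasDerivAt_CTerm (p : ℂ × ℕ) {x : ℝ} (hx : 0 < x) :
    HasDerivAt (CTerm p)
      (p.1 * CTerm (p.1 - 1, p.2) x + p.2 * CTerm (p.1 - 1, p.2 - 1) x) x := by
  have hxC : (x : ℂ) ≠ 0 := by exact_mod_cast hx.ne'
  have h1 : HasDerivAt (fun y : ℝ => (y : ℂ) ^ p.1) (p.1 * (x : ℂ) ^ (p.1 - 1)) x := by
    have h0 := ((hasDerivAt_id (x : ℂ)).cpow_const (c := p.1)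
      (Complex.ofReal_mem_slitPlane.mpr hx)).comp_ofReal
    simpa using h0
  have h2 := (Real.hasDerivAt_log hx.ne').ofReal_comp.fun_pow p.2
  refine (h1.mul h2).congr_deriv ?_
  simp only [CTerm, Complex.cpow_sub _ _ hxC, Complex.cpow_one, Complex.ofReal_inv]
  ring

lemma rpow_le_two_rpow_abs_mul_rpow {x y : ℝ} (hx : 0 < x) (hxy : x ≤ y) (hy : y ≤ 2 * x) (e : ℝ) :
    y ^ e ≤ 2 ^ |e| * x ^ e := by
  have h1 : 1 ≤ y / x := (one_le_div hx).mpr hxy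
  have h2 : y / x ≤ 2 := (div_le_iff₀ hx).mpr hy
  have h3 : y = (y / x) * x := by field_simp
  rw [h3, Real.mul_rpow (by linarith) hx.le]
  gcongr
  calc (y / x) ^ e ≤ (y / x) ^ |e| := Real.rpow_le_rpow_of_exponent_le h1 (le_abs_self e)
    _ ≤ 2 ^ |e| := Real.rpow_le_rpow (by linarith) h2 (abs_nonneg e)

/-- A Landau-type inequality: if `h = O(x ^ b)` and its derivative has an expansion with error
`O(x ^ (b - 1))`, then this expansion only involves exponents of real part at most `b - 1`. -/
lemma re_le_of_hasDerivAt_of_isBigO {h h' : ℝ → ℂ} {s : Finset (ℂ × ℕ)} {A : ℂ × ℕ → ℂ} {b : ℝ}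
    (hd : ∀ x : ℝ, 1 < x → HasDerivAt h (h' x) x)
    (hO : h =O[atTop] fun x : ℝ => x ^ b)
    (hP : (fun x => h' x - ∑ p ∈ s, A p * CTerm p x) =O[atTop] fun x : ℝ => x ^ (b - 1)) :
    ∀ p ∈ s, A p ≠ 0 → p.1.re ≤ b - 1 := by
  classical
  by_contra! hne
  obtain ⟨q, hq, hAq, hqb⟩ := hne
  obtain ⟨p₀, hp₀, hmax⟩ := (s.filter fun p => A p ≠ 0).exists_max_image
    (fun p => p.1.re) ⟨q, Finset.mem_filter.mpr ⟨hq, hAq⟩⟩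
  obtain ⟨hp₀s, hAp₀⟩ := Finset.mem_filter.mp hp₀
  set r := p₀.1.re with hr
  have hrb : b - 1 < r := hqb.trans_le (hmax q (Finset.mem_filter.mpr ⟨hq, hAq⟩))
  set d := r - (b - 1) with hdd
  have hd0 : 0 < d := sub_pos.mpr hrb
  set P : ℝ → ℂ := fun x => ∑ p ∈ s, A p * CTerm p x with hPdef
  set P' : ℝ → ℂ := fun x => ∑ p ∈ s,
    A p * (p.1 * CTerm (p.1 - 1, p.2) x + p.2 * CTerm (p.1 - 1, p.2 - 1) x) with hP'def
  have hPd : ∀ x : ℝ, 0 < x → HasDerivAt P (P' x) x := fun x hx =>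
    HasDerivAt.fun_sum fun p _ => (hasDerivAt_CTerm p hx).const_mul (A p)
  have hP'O : P' =O[atTop] fun x : ℝ => x ^ (r - 1 + d / 8) := by
    refine IsBigO.fun_sum fun p hp => ?_
    by_cases hA : A p = 0
    · simp only [hA, zero_mul]
      exact isBigO_zero _ _
    · have hpr : (p.1 - 1).re < r - 1 + d / 8 := by
        have := hmax p (Finset.mem_filter.mpr ⟨hp, hA⟩)
        simp only [Complex.sub_re, Complex.one_re]
        linarith
      exact (((isLittleO_CTerm_rpow (p := (p.1 - 1, p.2)) hpr).isBigO.const_mul_left _).add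
        ((isLittleO_CTerm_rpow (p := (p.1 - 1, p.2 - 1)) hpr).isBigO.const_mul_left
          _)).const_mul_left _
  obtain ⟨C₁, hC₁, hb₁⟩ := hO.exists_nonneg
  obtain ⟨C₂, hC₂, hb₂⟩ := hP.exists_nonneg
  obtain ⟨C₃, hC₃, hb₃⟩ := hP'O.exists_nonneg
  obtain ⟨X, hX⟩ := eventually_atTop.mp ((hb₁.bound.and hb₂.bound).and hb₃.bound)
  set D₁ := C₁ * 2 ^ |b| with hD₁
  set D₂ := C₂ * 2 ^ |b - 1| with hD₂
  set D₃ := C₃ * 2 ^ |r - 1 + d / 8| with hD₃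
  have hD₁0 : 0 ≤ D₁ := by positivity
  have hD₂0 : 0 ≤ D₂ := by positivity
  have hD₃0 : 0 ≤ D₃ := by positivity
  have hPO : P =O[atTop] fun x : ℝ => x ^ (r - 3 * d / 8) := by
    refine IsBigO.of_bound (2 * D₁ + (D₂ + D₃)) ?_
    filter_upwards [eventually_ge_atTop X, eventually_gt_atTop 1] with x hxX hx1
    have hx0 : 0 < x := by linarith
    set τ := x ^ (-(d / 2)) with hτ
    have hτ0 : 0 < τ := Real.rpow_pos_of_pos hx0 _
    have hτ1 : τ ≤ 1 := Real.rpow_le_one_of_one_le_of_nonpos hx1.le (by linarith)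
    have hτx : 0 < τ * x := mul_pos hτ0 hx0
    have hbd : ∀ y ∈ Set.Icc x (x + τ * x), ‖h y‖ ≤ D₁ * x ^ b ∧
        ‖h' y - P y‖ ≤ D₂ * x ^ (b - 1) ∧ ‖P' y‖ ≤ D₃ * x ^ (r - 1 + d / 8) := by
      rintro y ⟨hy1, hy2⟩
      have hy0 : 0 < y := hx0.trans_le hy1
      have hy3 : y ≤ 2 * x := by nlinarith
      obtain ⟨⟨e1, e2⟩, e3⟩ := hX y (hxX.trans hy1)
      rw [Real.norm_of_nonneg (Real.rpow_nonneg hy0.le _)] at e1 e2 e3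
      have key := rpow_le_two_rpow_abs_mul_rpow hx0 hy1 hy3
      refine ⟨e1.trans ?_, e2.trans ?_, e3.trans ?_⟩
      · rw [hD₁, mul_assoc]; gcongr; exact key _
      · rw [hD₂, mul_assoc]; gcongr; exact key _
      · rw [hD₃, mul_assoc]; gcongr; exact key _
    have hxm : x ∈ Set.Icc x (x + τ * x) := ⟨le_rfl, by linarith⟩
    have hem : x + τ * x ∈ Set.Icc x (x + τ * x) := ⟨by linarith, le_rfl⟩
    have hPdiff : ∀ y ∈ Set.Icc x (x + τ * x),
        ‖P y - P x‖ ≤ D₃ * x ^ (r - 1 + d / 8) * (τ * x) := by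
      intro y hy
      have h0 := (convex_Icc x (x + τ * x)).norm_image_sub_le_of_norm_hasDerivWithin_le
        (fun z hz => (hPd z (hx0.trans_le hz.1)).hasDerivWithinAt)
        (fun z hz => (hbd z hz).2.2) hxm hy
      refine h0.trans ?_
      gcongr
      rw [Real.norm_of_nonneg (by linarith [hy.1])]
      linarith [hy.2]
    set E := D₂ * x ^ (b - 1) + D₃ * x ^ (r - 1 + d / 8) * (τ * x) with hE
    have hlin : ‖(h (x + τ * x) - (x + τ * x : ℝ) * P x) - (h x - (x : ℝ) * P x)‖
        ≤ E * (τ * x) := by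
      have h0 := (convex_Icc x (x + τ * x)).norm_image_sub_le_of_norm_hasDerivWithin_le
        (f := fun y : ℝ => h y - (y : ℂ) * P x) (f' := fun y => h' y - 1 * P x) (C := E)
        (fun z hz => ((hd z (hx1.trans_le hz.1)).sub
          ((hasDerivAt_id z).ofReal_comp.mul_const (P x))).hasDerivWithinAt)
        (fun z hz => ?_) hxm hem
      · refine h0.trans (le_of_eq ?_)
        rw [add_sub_cancel_left, Real.norm_of_nonneg hτx.le]
      · rw [one_mul]
        calc ‖h' z - P x‖ = ‖(h' z - P z) + (P z - P x)‖ := by congr 1; ring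
          _ ≤ ‖h' z - P z‖ + ‖P z - P x‖ := norm_add_le _ _
          _ ≤ E := add_le_add (hbd z hz).2.1 (hPdiff z hz)
    have hmain : (τ * x) * ‖P x‖ ≤ (τ * x) * (2 * D₁ * (x ^ b / (τ * x)) + E) := by
      calc (τ * x) * ‖P x‖ = ‖((τ * x : ℝ) : ℂ) * P x‖ := by
            rw [norm_mul, Complex.norm_real, Real.norm_of_nonneg hτx.le]
        _ = ‖h (x + τ * x) - h x - ((h (x + τ * x) - (x + τ * x : ℝ) * P x)
              - (h x - (x : ℝ) * P x))‖ := by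
            congr 1; push_cast; ring
        _ ≤ ‖h (x + τ * x)‖ + ‖h x‖ + E * (τ * x) :=
            (norm_sub_le _ _).trans (add_le_add (norm_sub_le _ _) hlin)
        _ ≤ D₁ * x ^ b + D₁ * x ^ b + E * (τ * x) :=
            add_le_add (add_le_add (hbd _ hem).1 (hbd _ hxm).1) le_rfl
        _ = _ := by field_simp; ring
    have hP1 := le_of_mul_le_mul_left hmain hτx
    have hmono : ∀ e : ℝ, e ≤ r - 3 * d / 8 → x ^ e ≤ x ^ (r - 3 * d / 8) := fun e he =>
      Real.rpow_le_rpow_of_exponent_le hx1.le he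
    have t1 : x ^ b / (τ * x) ≤ x ^ (r - 3 * d / 8) := by
      have : x ^ b / (τ * x) = x ^ (r - d / 2) := by
        rw [hτ, ← Real.rpow_add_one hx0.ne', ← Real.rpow_sub hx0]
        congr 1; rw [hdd]; ring
      rw [this]
      exact hmono _ (by linarith)
    have t2 : x ^ (b - 1) ≤ x ^ (r - 3 * d / 8) := hmono _ (by linarith)
    have t3 : x ^ (r - 1 + d / 8) * (τ * x) ≤ x ^ (r - 3 * d / 8) := by
      rw [hτ, ← Real.rpow_add_one hx0.ne', ← Real.rpow_add hx0]
      exact hmono _ (by linarith)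
    rw [Real.norm_of_nonneg (Real.rpow_nonneg hx0.le _)]
    calc ‖P x‖ ≤ 2 * D₁ * (x ^ b / (τ * x)) + (D₂ * x ^ (b - 1) +
          D₃ * (x ^ (r - 1 + d / 8) * (τ * x))) := by rw [← mul_assoc D₃]; exact hP1
      _ ≤ 2 * D₁ * x ^ (r - 3 * d / 8) + (D₂ * x ^ (r - 3 * d / 8) +
          D₃ * x ^ (r - 3 * d / 8)) := by gcongr
      _ = _ := by ring
  exact hAp₀ (eq_zero_of_isBigO_sum_CTerm hPO hp₀s (by linarith))

/-- Differentiable expansions: if each `F j` has an expansion with error `O(x ^ (-1 - δ - j))` and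
`F 0` has only exponents of real part less than `m`, then `F n = O(x ^ (c - n))` for some
`c < m`. -/
lemma exists_isBigO_of_expansions {F : ℕ → ℝ → ℂ} {n : ℕ} {δ m : ℝ} (hδ : 0 < δ) (hm : 0 < m)
    (hd : ∀ j : ℕ, ∀ x : ℝ, 1 < x → HasDerivAt (F j) (F (j + 1) x) x)
    (hexp : ∀ j : ℕ, j ≤ n → ∃ (s : Finset (ℂ × ℕ)) (A : ℂ × ℕ → ℂ),
      (∀ p ∈ s, p.1.re < m) ∧
      (fun x : ℝ => F j x - ∑ p ∈ s, A p * CTerm p x) =O[atTop] fun x : ℝ => x ^ (-1 - δ - j)) :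
    ∃ c < m, F n =O[atTop] fun x : ℝ => x ^ (c - n) := by
  obtain ⟨c, hcm, hc0, hc⟩ : ∃ c < m, 0 < c ∧ F 0 =O[atTop] fun x : ℝ => x ^ c := by
    obtain ⟨s, A, hs, hO⟩ := hexp 0 (Nat.zero_le n)
    obtain ⟨c, hc1, hc2, hc3⟩ : ∃ c < m, 0 < c ∧ ∀ p ∈ s, p.1.re < c := by
      rcases s.eq_empty_or_nonempty with rfl | hne
      · exact ⟨m / 2, by linarith, by linarith, by simp⟩
      · obtain ⟨p₀, hp₀, hmax⟩ := s.exists_max_image (fun p => p.1.re) hne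
        obtain ⟨c, h1, h2⟩ := exists_between (max_lt (hs p₀ hp₀) hm)
        exact ⟨c, h2, (le_max_right _ _).trans_lt h1, fun p hp =>
          (hmax p hp).trans_lt ((le_max_left _ _).trans_lt h1)⟩
    refine ⟨c, hc1, hc2, ?_⟩
    have h1 := (hO.trans (isBigO_rpow_rpow_atTop (b := c) (by push_cast; linarith))).add
      (isLittleO_sum_CTerm_rpow A fun p hp _ => hc3 p hp).isBigO
    simpa using h1
  have hind : ∀ j : ℕ, j ≤ n → ∀ c' > c, F j =O[atTop] fun x : ℝ => x ^ (c' - j) := by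
    intro j
    induction j with
    | zero =>
      intro _ c' hc'
      simpa using hc.trans (isBigO_rpow_rpow_atTop hc'.le)
    | succ j ih =>
      intro hj c' hc'
      obtain ⟨c'', h1, h2⟩ := exists_between hc'
      obtain ⟨s, A, -, hO⟩ := hexp (j + 1) hj
      have hre := re_le_of_hasDerivAt_of_isBigO (hd j) (ih (by omega) c'' h1)
        (hO.trans (isBigO_rpow_rpow_atTop (by push_cast; linarith)))
      have h3 := (hO.trans (isBigO_rpow_rpow_atTop (b := c' - (j + 1 : ℕ))
        (by push_cast; linarith))).add
        (isLittleO_sum_CTerm_rpow A fun p hp hA =>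
          (hre p hp hA).trans_lt (by push_cast; linarith)).isBigO
      simpa using h3
  obtain ⟨c', h1, h2⟩ := exists_between hcm
  exact ⟨c', h2, hind n le_rfl c' h1⟩

lemma aeval_bernoulli_eq_bernoulliFun (k : ℕ) (x : ℝ) :
    Polynomial.aeval x (Polynomial.bernoulli k) = bernoulliFun k x := by
  rw [bernoulliFun, Polynomial.eval_map_algebraMap]

lemma integral_bernoulliFun_fract_mul (k n : ℕ) (g : ℝ → ℂ) :
    ∫ x in (n : ℝ)..(n + 1 : ℕ), ((bernoulliFun k (Int.fract x) : ℝ) : ℂ) * g x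
      = ∫ x in (n : ℝ)..(n + 1 : ℕ), ((bernoulliFun k (x - n) : ℝ) : ℂ) * g x := by
  rw [intervalIntegral.integral_of_le (by simp), intervalIntegral.integral_of_le (by simp),
    integral_Ioc_eq_integral_Ioo, integral_Ioc_eq_integral_Ioo]
  refine setIntegral_congr_fun measurableSet_Ioo fun x hx => ?_
  have hfl : ⌊x⌋ = (n : ℤ) := by
    rw [Int.floor_eq_iff]
    have h2 := hx.2
    push_cast at h2 ⊢
    exact ⟨hx.1.le, h2⟩
  simp only [Int.fract, hfl, Int.cast_natCast]

lemma continuousOn_of_hasDerivWithinAt_Ici {F : ℕ → ℝ → ℂ}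
    (hF : ∀ k x, 1 ≤ x → HasDerivWithinAt (F k) (F (k + 1) x) (Set.Ici 1) x)
    (k : ℕ) : ContinuousOn (F k) (Set.Ici 1) :=
  fun x hx => (hF k x hx).continuousWithinAt

/-- One integration by parts against the periodized Bernoulli polynomial. -/
lemma integral_bernoulliFun_fract_mul_succ {F : ℕ → ℝ → ℂ}
    (hF : ∀ k x, 1 ≤ x → HasDerivWithinAt (F k) (F (k + 1) x) (Set.Ici 1) x)
    (k : ℕ) {n : ℕ} (hn : 1 ≤ n) :
    ∫ x in (n : ℝ)..(n + 1 : ℕ), ((bernoulliFun (k + 1) (Int.fract x) : ℝ) : ℂ) * F (k + 1) x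
      = (bernoulliFun (k + 1) 1 : ℝ) * F k (n + 1 : ℕ) - (bernoulliFun (k + 1) 0 : ℝ) * F k n
        - (k + 1) * ∫ x in (n : ℝ)..(n + 1 : ℕ),
            ((bernoulliFun k (Int.fract x) : ℝ) : ℂ) * F k x := by
  have hn1 : (1 : ℝ) ≤ n := by exact_mod_cast hn
  have hnn : (n : ℝ) ≤ (n + 1 : ℕ) := by simp
  have hsub : Set.uIcc (n : ℝ) (n + 1 : ℕ) ⊆ Set.Ici 1 := by
    rw [Set.uIcc_of_le hnn]
    exact fun x hx => hn1.trans hx.1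
  rw [integral_bernoulliFun_fract_mul, integral_bernoulliFun_fract_mul]
  have hB : ∀ x ∈ Set.uIcc (n : ℝ) (n + 1 : ℕ), HasDerivWithinAt
      (fun x : ℝ => ((bernoulliFun (k + 1) (x - n) : ℝ) : ℂ))
      ((k + 1) * ((bernoulliFun k (x - n) : ℝ) : ℂ)) (Set.uIcc (n : ℝ) (n + 1 : ℕ)) x := by
    intro x _
    have h1 := ((hasDerivAt_bernoulliFun (k + 1) (x - n)).comp_sub_const x (n : ℝ)).ofReal_comp
    refine (h1.congr_deriv ?_).hasDerivWithinAt
    simp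
  have hcont : Continuous fun x : ℝ => ((k : ℂ) + 1) * ((bernoulliFun k (x - n) : ℝ) : ℂ) :=
    continuous_const.mul (Complex.continuous_ofReal.comp
      ((continuous_bernoulliFun k).comp (continuous_id.sub continuous_const)))
  rw [intervalIntegral.integral_mul_deriv_eq_deriv_mul_of_hasDerivWithinAt hB
    (fun x hx => (hF k x (hsub hx)).mono hsub) (hcont.intervalIntegrable _ _)
    ((continuousOn_of_hasDerivWithinAt_Ici hF (k + 1)).mono hsub).intervalIntegrable]
  rw [← intervalIntegral.integral_const_mul]
  congr 1
  · simp
  · simp only [mul_assoc]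

/-- The Euler–Maclaurin formula on the interval `[n, n + 1]`. -/
lemma euler_maclaurin_unit_interval {F : ℕ → ℝ → ℂ}
    (hF : ∀ k x, 1 ≤ x → HasDerivWithinAt (F k) (F (k + 1) x) (Set.Ici 1) x)
    (M : ℕ) {n : ℕ} (hn : 1 ≤ n) :
    1 / ((2 * M + 1).factorial : ℂ) * ∫ x in (n : ℝ)..(n + 1 : ℕ),
        ((bernoulliFun (2 * M + 1) (Int.fract x) : ℝ) : ℂ) * F (2 * M + 1) x
      = 1 / 2 * (F 0 n + F 0 (n + 1 : ℕ)) - (∫ x in (n : ℝ)..(n + 1 : ℕ), F 0 x)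
        - ∑ k ∈ Finset.Icc 1 M, ((bernoulli (2 * k) : ℚ) : ℂ) / ((2 * k).factorial : ℂ) *
          (F (2 * k - 1) (n + 1 : ℕ) - F (2 * k - 1) n) := by
  induction M with
  | zero =>
    rw [mul_zero, integral_bernoulliFun_fract_mul_succ hF 0 hn]
    simp
    ring
  | succ M ih =>
    rw [Finset.sum_Icc_succ_top (by omega), ← sub_sub, ← ih,
      show 2 * (M + 1) = 2 * M + 1 + 1 by ring,
      integral_bernoulliFun_fract_mul_succ hF _ hn, integral_bernoulliFun_fract_mul_succ hF _ hn,
      bernoulliFun_endpoints_eq_of_ne_one (by omega),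
      bernoulliFun_endpoints_eq_of_ne_one (by omega),
      bernoulliFun_eval_zero, bernoulliFun_eval_zero,
      bernoulli_eq_zero_of_odd (n := 2 * M + 1 + 1 + 1) ⟨M + 1, by ring⟩ (by omega)]
    have h0 : ((2 * M + 1).factorial : ℂ) ≠ 0 := by exact_mod_cast Nat.factorial_ne_zero _
    have h1 : ((2 * M + 1 : ℕ) : ℂ) + 1 ≠ 0 := Nat.cast_add_one_ne_zero _
    have h2 : ((2 * M + 1 + 1 : ℕ) : ℂ) + 1 ≠ 0 := Nat.cast_add_one_ne_zero _
    rw [Nat.factorial_succ (2 * M + 1 + 1), Nat.factorial_succ (2 * M + 1), Nat.add_sub_cancel]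
    simp only [Nat.cast_mul, Nat.cast_succ (2 * M + 1 + 1), Nat.cast_succ (2 * M + 1),
      Complex.ofReal_ratCast] at h2 ⊢
    simp only [Rat.cast_zero]
    field_simp
    ring

/-- The Euler–Maclaurin formula for a finite sum. -/
lemma euler_maclaurin_finite {F : ℕ → ℝ → ℂ}
    (hF : ∀ k x, 1 ≤ x → HasDerivWithinAt (F k) (F (k + 1) x) (Set.Ici 1) x)
    (M : ℕ)
    (hBF : IntegrableOn (fun x : ℝ => ((bernoulliFun (2 * M + 1) (Int.fract x) : ℝ) : ℂ) *
      F (2 * M + 1) x) (Set.Ioi 1)) {N : ℕ} (hN : 1 ≤ N) :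
    ∑ l ∈ Finset.Icc 1 N, F 0 l
      = (∫ x in (1 : ℝ)..N, F 0 x)
        + ∑ k ∈ Finset.Icc 1 M, ((bernoulli (2 * k) : ℚ) : ℂ) / ((2 * k).factorial : ℂ) *
          (F (2 * k - 1) N - F (2 * k - 1) 1)
        + 1 / 2 * F 0 1 + 1 / 2 * F 0 N
        + 1 / ((2 * M + 1).factorial : ℂ) * ∫ x in (1 : ℝ)..N,
            ((bernoulliFun (2 * M + 1) (Int.fract x) : ℝ) : ℂ) * F (2 * M + 1) x := by
  have hB : ∀ a b : ℝ, 1 ≤ a → 1 ≤ b → IntervalIntegrable (fun x : ℝ =>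
      ((bernoulliFun (2 * M + 1) (Int.fract x) : ℝ) : ℂ) * F (2 * M + 1) x) volume a b := by
    intro a b ha hb
    rw [intervalIntegrable_iff]
    exact hBF.mono_set fun x hx => (le_min ha hb).trans_lt hx.1
  have hF0 : ∀ a b : ℝ, 1 ≤ a → 1 ≤ b → IntervalIntegrable (F 0) volume a b := by
    intro a b ha hb
    exact ((continuousOn_of_hasDerivWithinAt_Ici hF 0).mono
      fun x hx => (le_min ha hb).trans hx.1).intervalIntegrable
  induction N, hN using Nat.le_induction with
  | base =>
    simp
    ring
  | succ n hn ih =>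
    have hn1 : (1 : ℝ) ≤ n := by exact_mod_cast hn
    have hn2 : (1 : ℝ) ≤ (n + 1 : ℕ) := by push_cast; linarith
    have hstep := euler_maclaurin_unit_interval hF M hn
    rw [Finset.sum_Icc_succ_top (by omega), ih,
      ← intervalIntegral.integral_add_adjacent_intervals (hB 1 n le_rfl hn1)
        (hB n (n + 1 : ℕ) hn1 hn2),
      ← intervalIntegral.integral_add_adjacent_intervals (hF0 1 n le_rfl hn1)
        (hF0 n (n + 1 : ℕ) hn1 hn2), mul_add, hstep]
    simp only [mul_sub, Finset.sum_sub_distrib]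
    ring

lemma HasRegLimAtTop.natCast {g : ℝ → ℂ} {c : ℂ} (h : HasRegLimAtTop g c) :
    HasRegLimSeq (fun N => g N) c := by
  obtain ⟨s, A, hs, ht⟩ := h
  exact ⟨s, A, hs, ht.comp tendsto_natCast_atTop_atTop⟩

namespace HasRegLimSeq

lemma of_tendsto {g : ℕ → ℂ} {c : ℂ} (h : Tendsto g atTop (𝓝 c)) : HasRegLimSeq g c :=
  ⟨∅, 0, by simp, by simpa using h.sub_const c⟩

lemma congr' {g g' : ℕ → ℂ} {c : ℂ} (h : HasRegLimSeq g c) (hg : g =ᶠ[atTop] g') :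
    HasRegLimSeq g' c := by
  obtain ⟨s, A, hs, ht⟩ := h
  refine ⟨s, A, hs, ht.congr' ?_⟩
  filter_upwards [hg] with N hN
  rw [hN]

lemma const_mul {g : ℕ → ℂ} {c : ℂ} (a : ℂ) (h : HasRegLimSeq g c) :
    HasRegLimSeq (fun N => a * g N) (a * c) := by
  obtain ⟨s, A, hs, ht⟩ := h
  refine ⟨s, fun p => a * A p, hs, ?_⟩
  have h1 := ht.const_mul a
  rw [mul_zero] at h1
  refine h1.congr fun N => ?_
  simp only [mul_assoc, ← Finset.mul_sum]
  ring

lemma add {g g' : ℕ → ℂ} {c c' : ℂ} (h : HasRegLimSeq g c) (h' : HasRegLimSeq g' c') :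
    HasRegLimSeq (fun N => g N + g' N) (c + c') := by
  classical
  obtain ⟨s, A, hs, ht⟩ := h
  obtain ⟨s', A', hs', ht'⟩ := h'
  refine ⟨s ∪ s', fun p => (if p ∈ s then A p else 0) + (if p ∈ s' then A' p else 0), ?_, ?_⟩
  · intro p hp
    rcases Finset.mem_union.mp hp with hp | hp
    exacts [hs p hp, hs' p hp]
  · have h1 := ht.add ht'
    rw [add_zero] at h1
    refine h1.congr fun N => ?_
    simp only [add_mul, Finset.sum_add_distrib, ite_mul, zero_mul, Finset.sum_ite_mem,
      Finset.union_inter_cancel_left, Finset.union_inter_cancel_right]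
    ring

lemma sum {ι : Type*} (t : Finset ι) {g : ι → ℕ → ℂ} {c : ι → ℂ}
    (h : ∀ i ∈ t, HasRegLimSeq (g i) (c i)) :
    HasRegLimSeq (fun N => ∑ i ∈ t, g i N) (∑ i ∈ t, c i) := by
  classical
  induction t using Finset.induction_on with
  | empty => simpa using of_tendsto tendsto_const_nhds
  | insert i t hi ih =>
    simp only [Finset.sum_insert hi]
    exact (h i (Finset.mem_insert_self i t)).add
      (ih fun j hj => h j (Finset.mem_insert_of_mem hj))

/-- The regularized limit of a sequence is unique. -/
lemma unique {g : ℕ → ℂ} {c c' : ℂ} (h : HasRegLimSeq g c) (h' : HasRegLimSeq g c') : c = c' := by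
  classical
  obtain ⟨s, A, hs, ht⟩ := h.add (h'.const_mul (-1))
  have h0 : ((0, 0) : ℂ × ℕ) ∉ s := fun hmem => (hs _ hmem).2 rfl
  have key := eq_zero_of_tendsto_sum_CTerm (insert (0, 0) s)
    (fun p => if p = (0, 0) then c + -1 * c' else A p) 0 ?_ ?_ (0, 0) (Finset.mem_insert_self _ _)
  · rw [if_pos rfl] at key
    linear_combination key
  · intro p hp
    rcases Finset.mem_insert.mp hp with rfl | hp
    · simp
    · exact (hs p hp).1
  · have h1 := ht.neg
    rw [neg_zero] at h1
    refine h1.congr fun N => ?_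
    have hsum : ∑ p ∈ s, (if p = (0, 0) then c + -1 * c' else A p) * CTerm p (N : ℝ)
        = ∑ p ∈ s, A p * CTerm p (N : ℝ) :=
      Finset.sum_congr rfl fun p hp => by rw [if_neg (hs p hp).2]
    rw [Finset.sum_insert h0, hsum]
    simp [CTerm]

end HasRegLimSeq

lemma integrableOn_bernoulliFun_fract_mul (k : ℕ) {g : ℝ → ℂ} {e : ℝ} (he : e < -1)
    (hg : ContinuousOn g (Set.Ici 1)) (hO : g =O[atTop] fun x : ℝ => x ^ e) :
    IntegrableOn (fun x : ℝ => ((bernoulliFun k (Int.fract x) : ℝ) : ℂ) * g x) (Set.Ioi 1) := by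
  have hgi : IntegrableOn g (Set.Ioi 1) :=
    ((hg.locallyIntegrableOn measurableSet_Ici).integrableOn_of_isBigO_atTop hO
      (integrableAtFilter_rpow_atTop_iff.mpr he)).mono_set Set.Ioi_subset_Ici_self
  obtain ⟨C, hC⟩ := isCompact_Icc.exists_bound_of_continuousOn
    (continuous_bernoulliFun k).continuousOn (s := Set.Icc (0 : ℝ) 1)
  have hmeas : Measurable fun x : ℝ => ((bernoulliFun k (Int.fract x) : ℝ) : ℂ) :=
    Complex.measurable_ofReal.comp ((continuous_bernoulliFun k).measurable.comp measurable_fract)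
  refine hgi.bdd_mul (c := C) hmeas.aestronglyMeasurable (Eventually.of_forall fun x => ?_)
  rw [Complex.norm_real]
  exact hC _ ⟨Int.fract_nonneg x, (Int.fract_lt_one x).le⟩
theorem stmt_4 (f : ℝ → ℂ) (hf : ContDiffOn ℝ (⊤ : ℕ∞) f (Set.Ici 1))
    (M : ℕ) (hM : 1 ≤ M) (δ : ℝ) (hδ : 0 < δ)
    -- the asymptotic expansion may be differentiated 2M+1 times, with `2M > Re α₁`:
    (hexp : ∀ j : ℕ, j ≤ 2 * M + 1 → ∃ (s : Finset (ℂ × ℕ)) (A : ℂ × ℕ → ℂ),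
      (∀ p ∈ s, p.1.re < 2 * M) ∧
      (fun x : ℝ => iteratedDerivWithin j f (Set.Ici 1) x - ∑ p ∈ s, A p * CTerm p x)
        =O[atTop] fun x : ℝ => x ^ (-1 - δ - j))
    -- the regularized sum, the regularized integral, and the regularized limits:
    (S I L₀ : ℂ) (L : ℕ → ℂ)
    (hS : HasRegLimSeq (fun N => ∑ l ∈ Finset.Icc 1 N, f (l : ℝ)) S)
    (hI : HasRegInt f 1 I)
    (hL₀ : HasRegLimAtTop f L₀)
    (hL : ∀ k ∈ Finset.Icc 1 M,
      HasRegLimAtTop (iteratedDerivWithin (2 * k - 1) f (Set.Ici 1)) (L k)) :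
    S = I
      + ∑ k ∈ Finset.Icc 1 M, ((bernoulli (2 * k) : ℚ) : ℂ) / ((2 * k).factorial : ℂ) *
          (L k - iteratedDerivWithin (2 * k - 1) f (Set.Ici 1) 1)
      + (1 / 2) * f 1 + (1 / 2) * L₀
      + (1 / ((2 * M + 1).factorial : ℂ)) *
          ∫ x in Set.Ioi (1 : ℝ),
            ((Polynomial.aeval (Int.fract x) (Polynomial.bernoulli (2 * M + 1)) : ℝ) : ℂ) *
              iteratedDerivWithin (2 * M + 1) f (Set.Ici 1) x := by
  set F : ℕ → ℝ → ℂ := fun k => iteratedDerivWithin k f (Set.Ici 1) with hFdef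
  have hF : ∀ k x, 1 ≤ x → HasDerivWithinAt (F k) (F (k + 1) x) (Set.Ici 1) x := by
    intro k x hx
    have h1 := (hf.differentiableOn_iteratedDerivWithin (m := k)
      (by exact_mod_cast ENat.natCast_lt_top k) (uniqueDiffOn_Ici 1) x hx).hasDerivWithinAt
    simpa only [hFdef, iteratedDerivWithin_succ] using h1
  have hF0 : F 0 = f := iteratedDerivWithin_zero
  have hM0 : (0 : ℝ) < 2 * M := by exact_mod_cast (by omega : 0 < 2 * M)
  obtain ⟨c, hc, hO⟩ := exists_isBigO_of_expansions (F := F) hδ hM0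
    (fun k x hx => (hF k x hx.le).hasDerivAt (Ici_mem_nhds hx)) hexp
  have hBF := integrableOn_bernoulliFun_fract_mul (2 * M + 1) (by push_cast; linarith)
    (continuousOn_of_hasDerivWithinAt_Ici hF (2 * M + 1)) hO
  have hI' : HasRegLimAtTop (fun R => ∫ x in (1 : ℝ)..R, f x) I := by
    rcases hI with ⟨-, h⟩ | ⟨h, -⟩
    · exact h
    · exact absurd h one_ne_zero
  have hrem := HasRegLimSeq.of_tendsto
    (intervalIntegral_tendsto_integral_Ioi 1 hBF (tendsto_natCast_atTop_atTop (R := ℝ)))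
  have hsum := HasRegLimSeq.sum (Finset.Icc 1 M) fun k hk =>
    ((hL k hk).natCast.add (.of_tendsto (tendsto_const_nhds (x := -F (2 * k - 1) 1)))).const_mul
      (((bernoulli (2 * k) : ℚ) : ℂ) / ((2 * k).factorial : ℂ))
  have htotal := (((hI'.natCast.add hsum).add
    (.of_tendsto (tendsto_const_nhds (x := 1 / 2 * f 1)))).add
      (hL₀.natCast.const_mul (1 / 2))).add (hrem.const_mul (1 / ((2 * M + 1).factorial : ℂ)))
  simp only [aeval_bernoulli_eq_bernoulliFun]
  refine hS.unique ((htotal.congr' ?_))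
  filter_upwards [eventually_ge_atTop 1] with N hN
  have hEM := euler_maclaurin_finite hF M hBF hN
  rw [hF0] at hEM
  exact hEM.symm
end

section
/- Let f ∈ C^∞(ℝ₊² \ {(0,0)}) be homogeneous of degree α ∈ ℂ with α + 2 ≠ 0, and let b > 0. Define d_{α+1} to be the coefficient of x^{α-j} y^j with j such that α - j = -1 in the Taylor expansion f(x,y) ~ Σ_j d_j x^{α-j} y^j as x → ∞ (set d_{α+1} = 0 if α + 1 ∉ ℤ₊). Then LIM_{z→∞} z^{α+2} ⨍_{b/z}^∞ f(1,y) dy = -d_{α+1} b^{α+2}/(α+2), and LIM_{z→0} z^{α+2} ⨍_{b/z}^∞ f(1,y) dy = 0. -/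
open MeasureTheory Filter Asymptotics

/-- The exponential monomial `t ↦ exp (l * t) * t ^ k`. -/
noncomputable def expMonomial (l : ℂ) (k : ℕ) (t : ℝ) : ℂ :=
  Complex.exp (l * t) * (t : ℂ) ^ k

lemma CTerm_exp (p : ℂ × ℕ) (t : ℝ) : CTerm p (Real.exp t) = expMonomial p.1 p.2 t := by
  unfold CTerm expMonomial
  rw [Real.log_exp, Complex.cpow_def_of_ne_zero (by exact_mod_cast (Real.exp_pos t).ne'),
    ← Complex.ofReal_log (Real.exp_pos t).le, Real.log_exp, mul_comm (t : ℂ)]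

/-- The functions `ℝ → ℂ` vanishing at `+∞`. -/
def vanishingAtTop : Submodule ℂ (ℝ → ℂ) where
  carrier := {g | Tendsto g atTop (nhds 0)}
  add_mem' := fun ha hb => (add_zero (0 : ℂ)) ▸ Tendsto.add ha hb
  zero_mem' := tendsto_const_nhds
  smul_mem' := fun c _ hg => (smul_zero (A := ℂ) c) ▸ Tendsto.const_smul hg c

/-- Translation by `h` on functions modulo those vanishing at `+∞`. -/
noncomputable def shiftQuot (h : ℝ) : Module.End ℂ ((ℝ → ℂ) ⧸ vanishingAtTop) :=
  vanishingAtTop.mapQ vanishingAtTop (LinearMap.funLeft ℂ ℂ (fun t : ℝ => t + h))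
    (fun g (hg : Tendsto g atTop (nhds 0)) =>
      hg.comp (tendsto_atTop_add_const_right _ h tendsto_id))

lemma mem_maxGenEigenspace_of_sub_mem {V : Type*} [AddCommGroup V] [Module ℂ V]
    (T : Module.End ℂ V) (m : ℂ) (x : V) (hx : T x - m • x ∈ T.maxGenEigenspace m) :
    x ∈ T.maxGenEigenspace m := by
  rw [Module.End.mem_maxGenEigenspace] at hx ⊢
  obtain ⟨k, hk⟩ := hx
  refine ⟨k + 1, ?_⟩
  rw [pow_succ, Module.End.mul_apply]
  simpa using hk

lemma expMonomial_shift (l : ℂ) (k : ℕ) (h : ℝ) :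
    LinearMap.funLeft ℂ ℂ (fun t : ℝ => t + h) (expMonomial l k)
      - Complex.exp (l * h) • expMonomial l k
      = ∑ j ∈ Finset.range k,
          (Complex.exp (l * h) * (h : ℂ) ^ (k - j) * (k.choose j : ℂ)) • expMonomial l j := by
  ext t
  simp only [Pi.sub_apply, Pi.smul_apply, LinearMap.funLeft_apply, Finset.sum_apply, smul_eq_mul,
    expMonomial]
  push_cast
  rw [mul_add, Complex.exp_add, add_pow, Finset.sum_range_succ, mul_add, Finset.mul_sum]
  simp only [Nat.sub_self, pow_zero, Nat.choose_self, Nat.cast_one, mul_one]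
  rw [add_sub_assoc, show Complex.exp (l * t) * Complex.exp (l * h) * (t : ℂ) ^ k
    - Complex.exp (l * h) * (Complex.exp (l * t) * (t : ℂ) ^ k) = 0 by ring, add_zero]
  exact Finset.sum_congr rfl fun j _ => by ring

lemma mkQ_expMonomial_mem (l : ℂ) (h : ℝ) (k : ℕ) :
    vanishingAtTop.mkQ (expMonomial l k) ∈
      (shiftQuot h).maxGenEigenspace (Complex.exp (l * h)) := by
  induction k using Nat.strong_induction_on with
  | _ k ih =>
    apply mem_maxGenEigenspace_of_sub_mem
    have key : shiftQuot h (vanishingAtTop.mkQ (expMonomial l k))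
        - Complex.exp (l * h) • vanishingAtTop.mkQ (expMonomial l k)
        = vanishingAtTop.mkQ (LinearMap.funLeft ℂ ℂ (fun t : ℝ => t + h) (expMonomial l k)
      - Complex.exp (l * h) • expMonomial l k) := by
      rw [map_sub, map_smul]
      rfl
    rw [key, expMonomial_shift, map_sum]
    refine Submodule.sum_mem _ fun j hj => ?_
    rw [map_smul]
    exact Submodule.smul_mem _ _ (ih j (Finset.mem_range.mp hj))

lemma exists_shift_exp_ne_one (s : Finset (ℂ × ℕ)) :
    ∃ h : ℝ, ∀ p ∈ s, p.1 ≠ 0 → Complex.exp (p.1 * h) ≠ 1 := by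
  set M : ℝ := 1 + ∑ p ∈ s, ‖p.1‖ with hM
  have hM0 : 0 < M := by positivity
  refine ⟨M⁻¹, fun p hp hp0 he => ?_⟩
  obtain ⟨n, hn⟩ := Complex.exp_eq_one_iff.mp he
  have hlt : ‖p.1 * ((M⁻¹ : ℝ) : ℂ)‖ < 1 := by
    rw [norm_mul, Complex.norm_real, Real.norm_of_nonneg (inv_pos.mpr hM0).le,
      ← div_eq_mul_inv, div_lt_one hM0]
    have := Finset.single_le_sum (f := fun p : ℂ × ℕ => ‖p.1‖) (fun _ _ => norm_nonneg _) hp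
    linarith
  have hn0 : n ≠ 0 := by
    rintro rfl
    simp [hp0] at hn
    exact hM0.ne' hn
  have h1 : (1 : ℝ) ≤ |(n : ℝ)| := by exact_mod_cast Int.one_le_abs hn0
  rw [hn] at hlt
  have h2 : ‖(n : ℂ) * (2 * (Real.pi : ℂ) * Complex.I)‖ = |(n : ℝ)| * (2 * Real.pi) := by
    simp [abs_of_pos Real.pi_pos]
  rw [h2] at hlt
  nlinarith [Real.pi_gt_three]

lemma Polynomial.eq_zero_of_tendsto_zero (P : Polynomial ℂ)
    (hP : Tendsto (fun t : ℝ => P.eval (t : ℂ)) atTop (nhds 0)) : P = 0 := by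
  by_cases hd : 0 < P.degree
  · have h1 := Polynomial.tendsto_norm_atTop P hd (l := atTop) (z := fun t : ℝ => (t : ℂ))
      (by simpa using tendsto_abs_atTop_atTop)
    exact absurd hP.norm (not_tendsto_nhds_of_tendsto_atTop h1 _)
  · rw [Polynomial.eq_C_of_degree_le_zero (not_lt.mp hd)] at hP ⊢
    simp only [Polynomial.eval_C] at hP
    rw [tendsto_nhds_unique tendsto_const_nhds hP, map_zero]

lemma eq_zero_of_hasRegLimAtTop_zero {c : ℂ} (hc : HasRegLimAtTop (fun _ => 0) c) : c = 0 := by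
  obtain ⟨s, A, hs, hlim⟩ := hc
  have hlim' := (hlim.comp Real.tendsto_exp_atTop).neg
  simp only [Function.comp_def, CTerm_exp, neg_zero] at hlim'
  obtain ⟨h, hh⟩ := exists_shift_exp_ne_one s
  set P : ℝ → ℂ := c • expMonomial 0 0 + ∑ p ∈ s with p.1 = 0, A p • expMonomial p.1 p.2 with hPdef
  set Q : ℝ → ℂ := ∑ p ∈ s with ¬ p.1 = 0, A p • expMonomial p.1 p.2 with hQdef
  have hPQ : P + Q ∈ vanishingAtTop := by
    refine hlim'.congr fun t => ?_
    rw [hPdef, hQdef, add_assoc, Finset.sum_filter_add_sum_filter_not]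
    simp [expMonomial]
  have hPm : vanishingAtTop.mkQ P ∈ (shiftQuot h).maxGenEigenspace 1 := by
    rw [hPdef, map_add, map_sum, map_smul]
    refine Submodule.add_mem _ (Submodule.smul_mem _ _ ?_) (Submodule.sum_mem _ fun p hp => ?_)
    · simpa using mkQ_expMonomial_mem 0 h 0
    · rw [map_smul]
      refine Submodule.smul_mem _ _ ?_
      have := mkQ_expMonomial_mem p.1 h p.2
      simpa [(Finset.mem_filter.mp hp).2] using this
  have hQm : vanishingAtTop.mkQ Q ∈ ⨆ m, ⨆ (_ : m ≠ 1), (shiftQuot h).maxGenEigenspace m := by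
    rw [hQdef, map_sum]
    refine Submodule.sum_mem _ fun p hp => ?_
    rw [map_smul]
    obtain ⟨hps, hp0⟩ := Finset.mem_filter.mp hp
    exact Submodule.smul_mem _ _ (Submodule.mem_iSup_of_mem _
      (Submodule.mem_iSup_of_mem (hh p hps hp0) (mkQ_expMonomial_mem p.1 h p.2)))
  have hsum : vanishingAtTop.mkQ P + vanishingAtTop.mkQ Q = 0 := by
    rw [← map_add]
    exact (Submodule.Quotient.mk_eq_zero _).mpr hPQ
  have hP0 : vanishingAtTop.mkQ P = 0 := by
    refine Submodule.disjoint_def.mp ((shiftQuot h).independent_maxGenEigenspace 1) _ hPm ?_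
    rw [eq_neg_of_add_eq_zero_left hsum]
    exact Submodule.neg_mem _ hQm
  have hPW : Tendsto P atTop (nhds 0) := by
    have : P ∈ vanishingAtTop := by simpa using hP0
    exact this
  set p : Polynomial ℂ := Polynomial.C c +
    ∑ q ∈ s with q.1 = 0, Polynomial.C (A q) * Polynomial.X ^ q.2 with hp
  have hp0 : p = 0 := by
    refine Polynomial.eq_zero_of_tendsto_zero p (hPW.congr fun t => ?_)
    simp only [hPdef, hp, Pi.add_apply, Pi.smul_apply, Finset.sum_apply, smul_eq_mul,
      Polynomial.eval_add, Polynomial.eval_C, Polynomial.eval_finsetSum, Polynomial.eval_mul,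
      Polynomial.eval_pow, Polynomial.eval_X, expMonomial]
    congr 1
    · simp
    · refine Finset.sum_congr rfl fun q hq => ?_
      simp [(Finset.mem_filter.mp hq).2]
  have hcoef : p.coeff 0 = c := by
    rw [hp, Polynomial.coeff_add, Polynomial.coeff_C_zero, Polynomial.finsetSum_coeff,
      Finset.sum_eq_zero, add_zero]
    intro q hq
    obtain ⟨hqs, hq0⟩ := Finset.mem_filter.mp hq
    have : q.2 ≠ 0 := fun h2 => (hs q hqs).2 (Prod.ext hq0 h2)
    simp [Polynomial.coeff_X_pow, this.symm]
  rw [← hcoef, hp0, Polynomial.coeff_zero]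

lemma HasRegLimAtTop.add {g g' : ℝ → ℂ} {c c' : ℂ} (h : HasRegLimAtTop g c)
    (h' : HasRegLimAtTop g' c') : HasRegLimAtTop (fun x => g x + g' x) (c + c') := by
  classical
  obtain ⟨s, A, hs, hl⟩ := h
  obtain ⟨s', A', hs', hl'⟩ := h'
  refine ⟨s ∪ s', fun p => (if p ∈ s then A p else 0) + (if p ∈ s' then A' p else 0),
    fun p hp => (Finset.mem_union.mp hp).elim (hs p) (hs' p), ?_⟩
  have := hl.add hl'
  rw [add_zero] at this
  refine this.congr fun x => ?_
  simp only [add_mul, Finset.sum_add_distrib, ite_mul, zero_mul]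
  rw [← Finset.sum_filter, ← Finset.sum_filter,
    show (s ∪ s').filter (· ∈ s) = s by ext; simp +contextual,
    show (s ∪ s').filter (· ∈ s') = s' by ext; simp +contextual]
  ring

lemma HasRegLimAtTop.const_mul {g : ℝ → ℂ} {c : ℂ} (h : HasRegLimAtTop g c) (a : ℂ) :
    HasRegLimAtTop (fun x => a * g x) (a * c) := by
  obtain ⟨s, A, hs, hl⟩ := h
  refine ⟨s, fun p => a * A p, hs, ?_⟩
  have := hl.const_mul a
  rw [mul_zero] at this
  refine this.congr fun x => ?_
  simp only [mul_sub, Finset.mul_sum, mul_assoc]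

lemma HasRegLimAtTop.congr' {g g' : ℝ → ℂ} {c : ℂ} (h : HasRegLimAtTop g c)
    (he : g =ᶠ[atTop] g') : HasRegLimAtTop g' c := by
  obtain ⟨s, A, hs, hl⟩ := h
  refine ⟨s, A, hs, hl.congr' ?_⟩
  filter_upwards [he] with x hx
  rw [hx]

lemma hasRegLimAtTop_of_tendsto {g : ℝ → ℂ} {c : ℂ} (h : Tendsto g atTop (nhds c)) :
    HasRegLimAtTop g c :=
  ⟨∅, 0, by simp, by simpa using h.sub_const c⟩

lemma HasRegLimAtTop.sum {ι : Type*} (u : Finset ι) {g : ι → ℝ → ℂ} {c : ι → ℂ}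
    (h : ∀ i ∈ u, HasRegLimAtTop (g i) (c i)) :
    HasRegLimAtTop (fun x => ∑ i ∈ u, g i x) (∑ i ∈ u, c i) := by
  classical
  induction u using Finset.induction_on with
  | empty => simpa using hasRegLimAtTop_of_tendsto (tendsto_const_nhds (x := (0 : ℂ)))
  | insert i u hi ih =>
    simp only [Finset.sum_insert hi]
    exact (h i (Finset.mem_insert_self i u)).add
      (ih fun j hj => h j (Finset.mem_insert_of_mem hj))

lemma HasRegLimAtTop.unique {g : ℝ → ℂ} {c c' : ℂ} (h : HasRegLimAtTop g c)
    (h' : HasRegLimAtTop g c') : c = c' := by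
  have := eq_zero_of_hasRegLimAtTop_zero (c := c + -1 * c')
    ((h.add (h'.const_mul (-1))).congr' (Eventually.of_forall fun x => by simp))
  linear_combination this

lemma tendsto_cpow_atTop_zero {e : ℂ} (he : e.re < 0) :
    Tendsto (fun x : ℝ => (x : ℂ) ^ e) atTop (nhds 0) := by
  rw [tendsto_zero_iff_norm_tendsto_zero]
  have h := tendsto_rpow_neg_atTop (y := -e.re) (by linarith)
  rw [neg_neg] at h
  refine h.congr' ?_
  filter_upwards [eventually_gt_atTop 0] with x hx
  rw [Complex.norm_cpow_eq_rpow_re_of_pos hx]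

lemma hasRegLimAtTop_cpow {e : ℂ} (he : e ≠ 0) :
    HasRegLimAtTop (fun x : ℝ => (x : ℂ) ^ e) 0 := by
  by_cases hre : e.re < 0
  · exact hasRegLimAtTop_of_tendsto (tendsto_cpow_atTop_zero hre)
  · refine ⟨{(e, 0)}, 1, ?_, ?_⟩
    · simpa [he] using hre
    · simp [CTerm]

lemma hasRegLimAtTop_log : HasRegLimAtTop (fun x : ℝ => (Real.log x : ℂ)) 0 :=
  ⟨{(0, 1)}, 1, by simp, by simp [CTerm]⟩

lemma hasRegLimAtTop_cpow_ite (e : ℂ) :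
    HasRegLimAtTop (fun x : ℝ => (x : ℂ) ^ e) (if e = 0 then 1 else 0) := by
  split_ifs with he
  · simpa [he] using hasRegLimAtTop_of_tendsto (tendsto_const_nhds (x := (1 : ℂ)))
  · exact hasRegLimAtTop_cpow he

lemma exists_taylor_bound {g : ℝ → ℂ} (hg : ContDiffOn ℝ (⊤ : ℕ∞) g (Set.Ici 0)) (n : ℕ) :
    ∃ C : ℝ, 0 ≤ C ∧ ∀ t ∈ Set.Icc (0 : ℝ) 1,
      ‖g t - ∑ j ∈ Finset.range (n + 1),
        ((j.factorial : ℂ)⁻¹ * iteratedDerivWithin j g (Set.Ici 0) 0) * (t : ℂ) ^ j‖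
        ≤ C * t ^ (n + 1) := by
  obtain ⟨C, hC⟩ := exists_taylor_mean_remainder_bound (f := g) (n := n) (zero_le_one' ℝ)
    ((hg.mono Set.Icc_subset_Ici_self).of_le (by exact_mod_cast le_top))
  refine ⟨|C|, abs_nonneg C, fun t ht => ?_⟩
  have h := hC t ht
  have hset : Set.Icc (0 : ℝ) 1 =ᶠ[nhds 0] Set.Ici 0 := by
    filter_upwards [Iio_mem_nhds (zero_lt_one' ℝ)] with x hx
    exact propext ⟨fun h => h.1, fun h => ⟨h, le_of_lt hx⟩⟩
  have hder (j : ℕ) : iteratedDerivWithin j g (Set.Icc 0 1) 0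
      = iteratedDerivWithin j g (Set.Ici 0) 0 := by
    simp only [iteratedDerivWithin, iteratedFDerivWithin_congr_set hset]
  simp only [taylor_within_apply, hder, sub_zero] at h
  have heq : ∑ j ∈ Finset.range (n + 1),
        ((j.factorial : ℂ)⁻¹ * iteratedDerivWithin j g (Set.Ici 0) 0) * (t : ℂ) ^ j
      = ∑ j ∈ Finset.range (n + 1),
        ((j.factorial : ℝ)⁻¹ * t ^ j) • iteratedDerivWithin j g (Set.Ici 0) 0 := by
    refine Finset.sum_congr rfl fun j _ => ?_
    rw [Complex.real_smul]
    push_cast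
    ring
  rw [heq]
  exact h.trans (mul_le_mul_of_nonneg_right (le_abs_self C) (pow_nonneg ht.1 _))

open Classical in
/-- A primitive of `y ↦ y ^ e` on the positive half-line without constant term at infinity. -/
noncomputable def regPrimitive (e : ℂ) (y : ℝ) : ℂ :=
  if e = -1 then (Real.log y : ℂ) else (y : ℂ) ^ (e + 1) / (e + 1)

lemma hasRegLimAtTop_regPrimitive (e : ℂ) : HasRegLimAtTop (regPrimitive e) 0 := by
  by_cases he : e = -1
  · exact hasRegLimAtTop_log.congr' (Eventually.of_forall fun y => by simp [regPrimitive, he])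
  · have h0 : e + 1 ≠ 0 := fun h => he (eq_neg_of_add_eq_zero_left h)
    have := (hasRegLimAtTop_cpow h0).const_mul (e + 1)⁻¹
    rw [mul_zero] at this
    refine this.congr' (Eventually.of_forall fun y => ?_)
    simp [regPrimitive, he, div_eq_inv_mul]

lemma intervalIntegrable_cpow_of_pos (e : ℂ) {a c : ℝ} (ha : 0 < a) (hc : 0 < c) :
    IntervalIntegrable (fun y : ℝ => (y : ℂ) ^ e) volume a c :=
  intervalIntegral.intervalIntegrable_cpow (Or.inr (Set.notMem_uIcc_of_lt ha hc))

lemma integral_cpow_eq_regPrimitive (e : ℂ) {a c : ℝ} (ha : 0 < a) (hc : 0 < c) :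
    ∫ y in a..c, (y : ℂ) ^ e = regPrimitive e c - regPrimitive e a := by
  have h0 := Set.notMem_uIcc_of_lt ha hc
  by_cases he : e = -1
  · simp only [regPrimitive, he, if_true, Complex.cpow_neg_one]
    have : ∫ y in a..c, ((y : ℂ))⁻¹ = ((∫ y in a..c, y⁻¹ : ℝ) : ℂ) := by
      rw [← intervalIntegral.integral_ofReal]
      simp
    rw [this, integral_inv h0, Real.log_div hc.ne' ha.ne']
    push_cast
    rfl
  · rw [integral_cpow (Or.inr ⟨he, h0⟩)]
    simp [regPrimitive, he, sub_div]

lemma exists_primitive_expansion_atTop {F : ℝ → ℂ} (hF : ContinuousOn F (Set.Ici 0))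
    {α : ℂ} {N : ℕ} (c : ℕ → ℂ) {C : ℝ} (hN : α.re - N < -1)
    (hb : ∀ y : ℝ, 1 ≤ y →
      ‖F y - ∑ j ∈ Finset.range N, c j * (y : ℂ) ^ (α - j)‖ ≤ C * y ^ (α.re - N)) :
    ∃ (L : ℂ) (K : ℝ), ∀ a : ℝ, 1 ≤ a →
      ‖(∫ y in (1 : ℝ)..a, F y) - ∑ j ∈ Finset.range N, c j * regPrimitive (α - j) a - L‖
        ≤ K * a ^ (α.re - N + 1) := by
  set S : ℝ → ℂ := fun y => ∑ j ∈ Finset.range N, c j * (y : ℂ) ^ (α - j) with hS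
  set r : ℝ → ℂ := fun y => F y - S y with hr
  have hScont : ContinuousOn S (Set.Ici 1) := by
    refine continuousOn_finsetSum _ fun j _ => continuousOn_const.mul ?_
    intro y hy
    exact (Complex.continuousAt_ofReal_cpow_const y _
      (Or.inr (zero_lt_one.trans_le hy).ne')).continuousWithinAt
  have hrcont : ContinuousOn r (Set.Ici 1) :=
    (hF.mono (Set.Ici_subset_Ici.mpr zero_le_one)).sub hScont
  have hdom : IntegrableOn (fun y : ℝ => C * y ^ (α.re - N)) (Set.Ioi 1) :=
    (integrableOn_Ioi_rpow_of_lt hN zero_lt_one).const_mul C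
  have hrint : IntegrableOn r (Set.Ioi 1) := by
    refine hdom.mono' ((hrcont.mono Set.Ioi_subset_Ici_self).aestronglyMeasurable
      measurableSet_Ioi) ?_
    filter_upwards [ae_restrict_mem measurableSet_Ioi] with y hy
    exact hb y (le_of_lt hy)
  refine ⟨(∫ y in Set.Ioi (1 : ℝ), r y) - ∑ j ∈ Finset.range N, c j * regPrimitive (α - j) 1,
    -C / (α.re - N + 1), fun a ha => ?_⟩
  have ha0 : 0 < a := zero_lt_one.trans_le ha
  have hFi : IntervalIntegrable F volume 1 a := by
    refine (hF.mono ?_).intervalIntegrable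
    rw [Set.uIcc_of_le ha]
    exact fun y hy => zero_le_one.trans hy.1
  have hSi : IntervalIntegrable S volume 1 a := by
    refine (hScont.mono ?_).intervalIntegrable
    rw [Set.uIcc_of_le ha]
    exact fun y hy => hy.1
  have hSint : ∫ y in (1 : ℝ)..a, S y
      = ∑ j ∈ Finset.range N, c j * regPrimitive (α - j) a
        - ∑ j ∈ Finset.range N, c j * regPrimitive (α - j) 1 := by
    rw [hS, intervalIntegral.integral_finsetSum fun j _ =>
      (intervalIntegrable_cpow_of_pos _ zero_lt_one ha0).const_mul _, ← Finset.sum_sub_distrib]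
    refine Finset.sum_congr rfl fun j _ => ?_
    rw [intervalIntegral.integral_const_mul, integral_cpow_eq_regPrimitive _ zero_lt_one ha0,
      mul_sub]
  have hrI : ∫ y in (1 : ℝ)..a, r y = (∫ y in (1 : ℝ)..a, F y) - ∫ y in (1 : ℝ)..a, S y :=
    intervalIntegral.integral_sub hFi hSi
  have hsplit := intervalIntegral.integral_Ioi_sub_Ioi hrint ha
  have hrew : (∫ y in (1 : ℝ)..a, F y) - ∑ j ∈ Finset.range N, c j * regPrimitive (α - j) a
      - ((∫ y in Set.Ioi (1 : ℝ), r y) - ∑ j ∈ Finset.range N, c j * regPrimitive (α - j) 1)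
      = - ∫ y in Set.Ioi a, r y := by
    linear_combination -hsplit - hrI + hSint
  rw [hrew, norm_neg]
  have hle : ‖∫ y in Set.Ioi a, r y‖ ≤ ∫ y in Set.Ioi a, C * y ^ (α.re - N) := by
    refine norm_integral_le_of_norm_le (hdom.mono_set (Set.Ioi_subset_Ioi ha)) ?_
    filter_upwards [ae_restrict_mem measurableSet_Ioi] with y hy
    exact hb y (ha.trans (le_of_lt hy))
  refine hle.trans (le_of_eq ?_)
  rw [integral_const_mul, integral_Ioi_rpow_of_lt hN ha0]
  ring

lemma norm_primitive_sub_taylor_le {F : ℝ → ℂ} (hF : ContinuousOn F (Set.Ici 0)) {M : ℕ}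
    (d : ℕ → ℂ) {C : ℝ} (hC : 0 ≤ C)
    (hb : ∀ y ∈ Set.Icc (0 : ℝ) 1,
      ‖F y - ∑ j ∈ Finset.range M, d j * (y : ℂ) ^ j‖ ≤ C * y ^ M)
    {a : ℝ} (ha : a ∈ Set.Icc (0 : ℝ) 1) :
    ‖(∫ y in (0 : ℝ)..a, F y) - ∑ j ∈ Finset.range M, d j * ((a : ℂ) ^ (j + 1) / (j + 1))‖
      ≤ C * a ^ (M + 1) := by
  have hFi : IntervalIntegrable F volume 0 a := by
    refine (hF.mono ?_).intervalIntegrable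
    rw [Set.uIcc_of_le ha.1]
    exact fun y hy => hy.1
  have hSi : IntervalIntegrable (fun y : ℝ => ∑ j ∈ Finset.range M, d j * (y : ℂ) ^ j)
      volume 0 a := Continuous.intervalIntegrable (by fun_prop) _ _
  have hSint : ∫ y in (0 : ℝ)..a, ∑ j ∈ Finset.range M, d j * (y : ℂ) ^ j
      = ∑ j ∈ Finset.range M, d j * ((a : ℂ) ^ (j + 1) / (j + 1)) := by
    rw [intervalIntegral.integral_finsetSum fun j _ =>
      Continuous.intervalIntegrable (by fun_prop) _ _]
    refine Finset.sum_congr rfl fun j _ => ?_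
    have : ∫ y in (0 : ℝ)..a, (y : ℂ) ^ j = ((∫ y in (0 : ℝ)..a, y ^ j : ℝ) : ℂ) := by
      rw [← intervalIntegral.integral_ofReal]
      simp
    rw [intervalIntegral.integral_const_mul, this, integral_pow]
    simp
  rw [← hSint, ← intervalIntegral.integral_sub hFi hSi]
  have := intervalIntegral.norm_integral_le_of_norm_le_const (a := 0) (b := a) (C := C * a ^ M)
    (f := fun y => F y - ∑ j ∈ Finset.range M, d j * (y : ℂ) ^ j) fun y hy => by
      rw [Set.uIoc_of_le ha.1] at hy
      refine (hb y ⟨hy.1.le, hy.2.trans ha.2⟩).trans ?_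
      have := hy.1.le
      gcongr
      exact hy.2
  rwa [sub_zero, abs_of_nonneg ha.1, mul_assoc, ← pow_succ] at this

lemma ofReal_div_cpow {b z : ℝ} (hb : 0 < b) (hz : 0 < z) (e : ℂ) :
    ((b / z : ℝ) : ℂ) ^ e = (b : ℂ) ^ e * (z : ℂ) ^ (-e) := by
  have hb' : (b : ℂ) ≠ 0 := by exact_mod_cast hb.ne'
  have hz' : (z : ℂ) ≠ 0 := by exact_mod_cast hz.ne'
  have hbz : ((b / z : ℝ) : ℂ) ≠ 0 := by exact_mod_cast (div_pos hb hz).ne'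
  rw [Complex.cpow_def_of_ne_zero hb', Complex.cpow_def_of_ne_zero hz',
    Complex.cpow_def_of_ne_zero hbz, ← Complex.exp_add, ← Complex.ofReal_log hb.le,
    ← Complex.ofReal_log hz.le, ← Complex.ofReal_log (div_pos hb hz).le,
    Real.log_div hb.ne' hz.ne']
  push_cast
  ring_nf

lemma tendsto_cpow_mul_regPrimitive {b : ℝ} (hb : 0 < b) (α : ℂ) (j : ℕ) :
    Tendsto (fun z : ℝ => (z : ℂ) ^ (α + 2) * regPrimitive (α - j) (b / z))
      (nhdsWithin 0 (Set.Ioi 0)) (nhds 0) := by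
  have hpow : Tendsto (fun z : ℝ => (z : ℂ) ^ (j + 1)) (nhdsWithin 0 (Set.Ioi 0)) (nhds 0) := by
    have : Continuous fun z : ℝ => (z : ℂ) ^ (j + 1) := by fun_prop
    simpa using (this.tendsto 0).mono_left nhdsWithin_le_nhds
  by_cases he : α - j = -1
  · have hα : α + 2 = ((j + 1 : ℕ) : ℂ) := by
      push_cast
      linear_combination he
    have hlog : Tendsto (fun z : ℝ => (z : ℂ) ^ j * ((z * Real.log z : ℝ) : ℂ))
        (nhdsWithin 0 (Set.Ioi 0)) (nhds 0) := by
      have : Continuous fun z : ℝ => (z : ℂ) ^ j * ((z * Real.log z : ℝ) : ℂ) :=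
        (by fun_prop : Continuous fun z : ℝ => (z : ℂ) ^ j).mul
          (Complex.continuous_ofReal.comp Real.continuous_mul_log)
      simpa using (this.tendsto 0).mono_left nhdsWithin_le_nhds
    have h := (hpow.mul_const (Real.log b : ℂ)).sub hlog
    rw [zero_mul, sub_zero] at h
    refine h.congr' ?_
    filter_upwards [self_mem_nhdsWithin] with z hz
    rw [hα, Complex.cpow_natCast, regPrimitive, if_pos he,
      Real.log_div hb.ne' (ne_of_gt hz)]
    push_cast
    ring
  · have h := hpow.mul_const ((b : ℂ) ^ (α - j + 1) / (α - j + 1))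
    rw [zero_mul] at h
    refine h.congr' ?_
    filter_upwards [self_mem_nhdsWithin] with z hz
    have hz' : (z : ℂ) ≠ 0 := by exact_mod_cast (ne_of_gt hz)
    rw [regPrimitive, if_neg he, ofReal_div_cpow hb hz, ← Complex.cpow_natCast,
      show ((j + 1 : ℕ) : ℂ) = (α + 2) + -(α - j + 1) by push_cast; ring, Complex.cpow_add _ _ hz']
    ring

lemma contDiffOn_slice_right {f : ℝ × ℝ → ℂ} (hsm : ContDiffOn ℝ (⊤ : ℕ∞) f Qset) :
    ContDiffOn ℝ (⊤ : ℕ∞) (fun t => f (1, t)) (Set.Ici 0) := by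
  refine hsm.comp (f := fun t : ℝ => ((1 : ℝ), t)) (by fun_prop) fun t ht => ?_
  exact ⟨⟨zero_le_one, ht⟩, by simp [Prod.ext_iff]⟩

lemma contDiffOn_slice_left {f : ℝ × ℝ → ℂ} (hsm : ContDiffOn ℝ (⊤ : ℕ∞) f Qset) :
    ContDiffOn ℝ (⊤ : ℕ∞) (fun t => f (t, 1)) (Set.Ici 0) := by
  refine hsm.comp (f := fun t : ℝ => (t, (1 : ℝ))) (by fun_prop) fun t ht => ?_
  exact ⟨⟨ht, zero_le_one⟩, by simp [Prod.ext_iff]⟩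

lemma Homog.slice_eq {f : ℝ × ℝ → ℂ} {α : ℂ} (h : Homog f α) {y : ℝ} (hy : 0 < y) :
    f (1, y) = (y : ℂ) ^ α * f (y⁻¹, 1) := by
  have := h y hy (y⁻¹, 1) ⟨⟨(inv_pos.mpr hy).le, zero_le_one⟩, by simp [Prod.ext_iff]⟩
  simpa [hy.ne'] using this

lemma exists_slice_expansion_atTop {f : ℝ × ℝ → ℂ} {α : ℂ}
    (hsm : ContDiffOn ℝ (⊤ : ℕ∞) f Qset) (hhom : Homog f α) (n : ℕ) :
    ∃ C : ℝ, ∀ y : ℝ, 1 ≤ y →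
      ‖f (1, y) - ∑ j ∈ Finset.range (n + 1), cCoef f j * (y : ℂ) ^ (α - j)‖
        ≤ C * y ^ (α.re - (n + 1 : ℕ)) := by
  obtain ⟨C, -, hC⟩ := exists_taylor_bound (contDiffOn_slice_left hsm) n
  refine ⟨C, fun y hy => ?_⟩
  have hy0 : 0 < y := zero_lt_one.trans_le hy
  have hy' : (y : ℂ) ≠ 0 := by exact_mod_cast hy0.ne'
  have h := hC y⁻¹ ⟨(inv_pos.mpr hy0).le, inv_le_one_of_one_le₀ hy⟩
  have hrew : f (1, y) - ∑ j ∈ Finset.range (n + 1), cCoef f j * (y : ℂ) ^ (α - j)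
      = (y : ℂ) ^ α * (f (y⁻¹, 1) - ∑ j ∈ Finset.range (n + 1), cCoef f j * ((y⁻¹ : ℝ) : ℂ) ^ j) := by
    rw [hhom.slice_eq hy0, mul_sub, Finset.mul_sum]
    congr 1
    refine Finset.sum_congr rfl fun j _ => ?_
    rw [Complex.cpow_sub _ _ hy', Complex.cpow_natCast]
    push_cast
    rw [inv_pow]
    ring
  rw [hrew, norm_mul, Complex.norm_cpow_eq_rpow_re_of_pos hy0, Real.rpow_sub hy0,
    Real.rpow_natCast]
  calc y ^ α.re * _ ≤ y ^ α.re * (C * y⁻¹ ^ (n + 1)) :=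
        mul_le_mul_of_nonneg_left h (Real.rpow_nonneg hy0.le _)
    _ = _ := by rw [inv_pow]; ring

lemma dCrit_eq_sum (f : ℝ × ℝ → ℂ) (α : ℂ) (u : ℕ → ℂ) {M : ℕ} (hM : α.re + 1 < M)
    (v : ℂ) (huv : ∀ j : ℕ, α + 1 = j → u j = v) :
    ∑ j ∈ Finset.range M, dCoef f j * u j * (if α + 1 - j = 0 then 1 else 0) = dCrit f α * v := by
  by_cases h : ∃ j : ℕ, α + 1 = (j : ℂ)
  · have hj := h.choose_spec
    rw [dCrit, dif_pos h]
    set k := h.choose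
    have hk : k < M := by
      have : α.re + 1 = k := by simpa using congrArg Complex.re hj
      exact_mod_cast this ▸ hM
    rw [Finset.sum_eq_single_of_mem k (Finset.mem_range.mpr hk)]
    · rw [huv k hj, if_pos (sub_eq_zero.mpr hj), mul_one]
    · intro j _ hjk
      rw [if_neg, mul_zero]
      rw [hj, sub_eq_zero]
      exact_mod_cast hjk.symm
  · rw [dCrit, dif_neg h, zero_mul]
    refine Finset.sum_eq_zero fun j _ => ?_
    rw [if_neg fun hj => h ⟨j, sub_eq_zero.mp hj⟩, mul_zero]

lemma intervalIntegrable_of_continuousOn_Ici {F : ℝ → ℂ} (hF : ContinuousOn F (Set.Ici 0))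
    {a c : ℝ} (ha : 0 ≤ a) (hc : 0 ≤ c) : IntervalIntegrable F volume a c :=
  (hF.mono fun _ hy => (le_inf ha hc).trans hy.1).intervalIntegrable

/-- The regularized integral equals its value at the lower endpoint `1` minus an ordinary
integral. -/
lemma regInt_eq_sub_integral {F : ℝ → ℂ} (hF : ContinuousOn F (Set.Ici 0))
    {α : ℂ} {N : ℕ} (c : ℕ → ℂ) {K : ℝ} {L : ℂ} (hN : α.re - N < -1)
    (hb : ∀ a : ℝ, 1 ≤ a →
      ‖(∫ y in (1 : ℝ)..a, F y) - ∑ j ∈ Finset.range N, c j * regPrimitive (α - j) a - L‖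
        ≤ K * a ^ (α.re - N + 1))
    {a : ℝ} (ha : 0 < a) {v : ℂ} (hv : HasRegInt F a v) :
    v = L - ∫ y in (1 : ℝ)..a, F y := by
  rcases hv with ⟨-, hv⟩ | ⟨h0, -⟩
  swap
  · exact absurd h0 ha.ne'
  refine hv.unique ?_
  have herr : Tendsto (fun R => (∫ y in (1 : ℝ)..R, F y)
      - ∑ j ∈ Finset.range N, c j * regPrimitive (α - j) R - L) atTop (nhds 0) := by
    have h := (tendsto_rpow_neg_atTop (y := -(α.re - N + 1)) (by linarith)).const_mul K
    rw [neg_neg, mul_zero] at h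
    exact squeeze_zero_norm' ((eventually_ge_atTop 1).mono hb) h
  have hP : HasRegLimAtTop (fun R => ∑ j ∈ Finset.range N, c j * regPrimitive (α - j) R) 0 := by
    simpa using HasRegLimAtTop.sum (Finset.range N)
      fun j _ => (hasRegLimAtTop_regPrimitive (α - j)).const_mul (c j)
  have h := ((hasRegLimAtTop_of_tendsto herr).add hP).add
    (hasRegLimAtTop_of_tendsto (tendsto_const_nhds (x := L - ∫ y in (1 : ℝ)..a, F y)))
  rw [zero_add, zero_add] at h
  refine h.congr' ?_
  filter_upwards [eventually_ge_atTop 0] with R hR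
  have := intervalIntegral.integral_interval_sub_left
    (intervalIntegrable_of_continuousOn_Ici hF zero_le_one hR)
    (intervalIntegrable_of_continuousOn_Ici hF zero_le_one ha.le)
  rw [← this]
  ring

lemma hasRegLimAtTop_cpow_mul {F J : ℝ → ℂ} {α : ℂ} (hα : α + 2 ≠ 0) {b : ℝ} (hb : 0 < b)
    {M : ℕ} (hM : α.re + 1 < M) (d : ℕ → ℂ) {C : ℝ} {K : ℂ}
    (hbd : ∀ a ∈ Set.Icc (0 : ℝ) 1,
      ‖(∫ y in (0 : ℝ)..a, F y) - ∑ j ∈ Finset.range M, d j * ((a : ℂ) ^ (j + 1) / (j + 1))‖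
        ≤ C * a ^ (M + 1))
    (hJ : ∀ z : ℝ, 0 < z → J z = K - ∫ y in (0 : ℝ)..(b / z), F y) :
    HasRegLimAtTop (fun z => (z : ℂ) ^ (α + 2) * J z)
      (∑ j ∈ Finset.range M,
        d j * (-((b : ℂ) ^ (j + 1) / (j + 1))) * (if α + 1 - j = 0 then 1 else 0)) := by
  set E : ℝ → ℂ := fun a =>
    (∫ y in (0 : ℝ)..a, F y) - ∑ j ∈ Finset.range M, d j * ((a : ℂ) ^ (j + 1) / (j + 1)) with hE
  have herr : Tendsto (fun z : ℝ => (z : ℂ) ^ (α + 2) * E (b / z)) atTop (nhds 0) := by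
    have h := (tendsto_rpow_neg_atTop (y := -(α.re + 1 - M)) (by linarith)).const_mul
      (C * b ^ (M + 1))
    rw [neg_neg, mul_zero] at h
    refine squeeze_zero_norm' ?_ h
    filter_upwards [eventually_ge_atTop b] with z hz
    have hz0 : 0 < z := hb.trans_le hz
    rw [norm_mul, Complex.norm_cpow_eq_rpow_re_of_pos hz0]
    calc z ^ (α + 2).re * ‖E (b / z)‖ ≤ z ^ (α + 2).re * (C * (b / z) ^ (M + 1)) :=
          mul_le_mul_of_nonneg_left (hbd _ ⟨(div_pos hb hz0).le, (div_le_one hz0).mpr hz⟩)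
            (Real.rpow_nonneg hz0.le _)
      _ = C * b ^ (M + 1) * z ^ (α.re + 1 - M) := by
          rw [show α.re + 1 - M = (α + 2).re - (M + 1 : ℕ) by push_cast; simp; ring,
            Real.rpow_sub hz0, Real.rpow_natCast, div_pow]
          ring
  have hsum := HasRegLimAtTop.sum (Finset.range M) fun j _ =>
    (hasRegLimAtTop_cpow_ite (α + 1 - j)).const_mul (d j * (-((b : ℂ) ^ (j + 1) / (j + 1))))
  have h := (((hasRegLimAtTop_cpow hα).const_mul K).add hsum).add
    ((hasRegLimAtTop_of_tendsto herr).const_mul (-1))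
  rw [mul_zero, mul_zero, zero_add, add_zero] at h
  refine h.congr' ?_
  filter_upwards [eventually_gt_atTop 0] with z hz
  have hz' : (z : ℂ) ≠ 0 := by exact_mod_cast hz.ne'
  have hS : ∑ j ∈ Finset.range M, d j * (-((b : ℂ) ^ (j + 1) / (j + 1))) * (z : ℂ) ^ (α + 1 - j)
      = -((z : ℂ) ^ (α + 2) *
        ∑ j ∈ Finset.range M, d j * (((b / z : ℝ) : ℂ) ^ (j + 1) / (j + 1))) := by
    rw [Finset.mul_sum, ← Finset.sum_neg_distrib]
    refine Finset.sum_congr rfl fun j _ => ?_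
    rw [show α + 1 - j = α + 2 - (j + 1 : ℕ) by push_cast; ring, Complex.cpow_sub _ _ hz',
      Complex.cpow_natCast]
    push_cast
    rw [div_pow]
    ring
  rw [hS, hJ z hz, hE]
  ring

lemma tendsto_cpow_mul_nhdsGT_zero {F J : ℝ → ℂ} {α : ℂ} {b : ℝ} (hb : 0 < b)
    {N : ℕ} (c : ℕ → ℂ) {K : ℝ} {L : ℂ}
    (hbd : ∀ a : ℝ, 1 ≤ a →
      ‖(∫ y in (1 : ℝ)..a, F y) - ∑ j ∈ Finset.range N, c j * regPrimitive (α - j) a - L‖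
        ≤ K * a ^ (α.re - N + 1))
    (hJ : ∀ z : ℝ, 0 < z → J z = L - ∫ y in (1 : ℝ)..(b / z), F y) :
    Tendsto (fun z : ℝ => (z : ℂ) ^ (α + 2) * J z) (nhdsWithin 0 (Set.Ioi 0)) (nhds 0) := by
  set E : ℝ → ℂ := fun a =>
    (∫ y in (1 : ℝ)..a, F y) - ∑ j ∈ Finset.range N, c j * regPrimitive (α - j) a - L with hE
  have herr : Tendsto (fun z : ℝ => (z : ℂ) ^ (α + 2) * E (b / z))
      (nhdsWithin 0 (Set.Ioi 0)) (nhds 0) := by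
    have h : Tendsto (fun z : ℝ => K * b ^ (α.re - N + 1) * z ^ (N + 1))
        (nhdsWithin 0 (Set.Ioi 0)) (nhds 0) := by
      have : Continuous fun z : ℝ => K * b ^ (α.re - N + 1) * z ^ (N + 1) := by fun_prop
      simpa using (this.tendsto 0).mono_left nhdsWithin_le_nhds
    refine squeeze_zero_norm' ?_ h
    filter_upwards [Ioc_mem_nhdsGT hb] with z hz
    rw [norm_mul, Complex.norm_cpow_eq_rpow_re_of_pos hz.1]
    calc z ^ (α + 2).re * ‖E (b / z)‖ ≤ z ^ (α + 2).re * (K * (b / z) ^ (α.re - N + 1)) :=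
          mul_le_mul_of_nonneg_left (hbd _ ((one_le_div hz.1).mpr hz.2))
            (Real.rpow_nonneg hz.1.le _)
      _ = K * b ^ (α.re - N + 1) * z ^ (N + 1) := by
          rw [← Real.rpow_natCast z (N + 1),
            show ((N + 1 : ℕ) : ℝ) = (α + 2).re - (α.re - N + 1) by push_cast; simp; ring,
            Real.rpow_sub hz.1, Real.div_rpow hb.le hz.1.le]
          ring
  have hsum : Tendsto (fun z : ℝ => ∑ j ∈ Finset.range N,
      c j * ((z : ℂ) ^ (α + 2) * regPrimitive (α - j) (b / z)))
      (nhdsWithin 0 (Set.Ioi 0)) (nhds 0) := by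
    simpa using tendsto_finsetSum (Finset.range N)
      fun j _ => (tendsto_cpow_mul_regPrimitive hb α j).const_mul (c j)
  have h := (herr.add hsum).neg
  rw [add_zero, neg_zero] at h
  refine h.congr' ?_
  filter_upwards [self_mem_nhdsWithin] with z hz
  have hS : ∑ j ∈ Finset.range N, c j * ((z : ℂ) ^ (α + 2) * regPrimitive (α - j) (b / z))
      = (z : ℂ) ^ (α + 2) * ∑ j ∈ Finset.range N, c j * regPrimitive (α - j) (b / z) := by
    rw [Finset.mul_sum]
    exact Finset.sum_congr rfl fun j _ => by ring
  rw [hS, hJ z hz, hE]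
  ring

/-- Lemma `LLimits`, part 1: for `α + 2 ≠ 0`, `b > 0`, the regularized limits of
`z^(α+2) ⨍_{b/z}^∞ f(1,y) dy` as `z → ∞` and as `z → 0` equal `-d_{α+1} b^(α+2)/(α+2)`
and `0` respectively. Here `I z` denotes the regularized integral `⨍_{b/z}^∞ f(1,y) dy`. -/
theorem stmt_6 (f : ℝ × ℝ → ℂ) (α : ℂ)
    (hsm : ContDiffOn ℝ (⊤ : ℕ∞) f Qset) (hhom : Homog f α)
    (hα : α + 2 ≠ 0) (b : ℝ) (hb : 0 < b)
    (I : ℝ → ℂ) (hI : ∀ z : ℝ, 0 < z → HasRegInt (fun y => f (1, y)) (b / z) (I z)) :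
    HasRegLimAtTop (fun z => (z : ℂ) ^ (α + 2) * I z)
      (-(dCrit f α) * (b : ℂ) ^ (α + 2) / (α + 2)) ∧
    HasRegLimAtZero (fun z => (z : ℂ) ^ (α + 2) * I z) 0 := by
  have hFs := contDiffOn_slice_right hsm
  have hF : ContinuousOn (fun y => f (1, y)) (Set.Ici 0) := hFs.continuousOn
  obtain ⟨n, hn⟩ := exists_nat_gt (α.re + 1)
  have hM : α.re + 1 < (n + 1 : ℕ) := by
    push_cast
    linarith
  obtain ⟨C, hC⟩ := exists_slice_expansion_atTop hsm hhom n
  obtain ⟨L, K, hL⟩ := exists_primitive_expansion_atTop hF (cCoef f) (by linarith) hC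
  obtain ⟨D, hD, hDb⟩ := exists_taylor_bound hFs n
  have hI1 : ∀ z : ℝ, 0 < z → I z = L - ∫ y in (1 : ℝ)..(b / z), f (1, y) := fun z hz =>
    regInt_eq_sub_integral hF (cCoef f) (by linarith) hL (div_pos hb hz) (hI z hz)
  have hI0 : ∀ z : ℝ, 0 < z →
      I z = (L + ∫ y in (0 : ℝ)..1, f (1, y)) - ∫ y in (0 : ℝ)..(b / z), f (1, y) := by
    intro z hz
    rw [hI1 z hz, ← intervalIntegral.integral_interval_sub_left
      (intervalIntegrable_of_continuousOn_Ici hF le_rfl (div_pos hb hz).le)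
      (intervalIntegrable_of_continuousOn_Ici hF le_rfl zero_le_one)]
    ring
  refine ⟨?_, ∅, 0, by simp, ?_⟩
  · have h := hasRegLimAtTop_cpow_mul hα hb hM (dCoef f)
      (fun a ha => norm_primitive_sub_taylor_le hF (dCoef f) hD hDb ha) hI0
    rw [dCrit_eq_sum f α (fun j => -((b : ℂ) ^ (j + 1) / (j + 1))) hM
      (-((b : ℂ) ^ (α + 2) / (α + 2)))] at h
    · convert h using 1
      ring
    · intro j hj
      rw [show α + 2 = ((j + 1 : ℕ) : ℂ) by push_cast; linear_combination hj, Complex.cpow_natCast]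
      push_cast
      rfl
  · simpa using tendsto_cpow_mul_nhdsGT_zero hb (cCoef f) hL hI1
end
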